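/- arXiv:2602.15559 — 3 statements merged into one kernel-verified Lean document; each statement's English description precedes it below -/
import Mathlib

section
/- For each n ≥ 2, let φ_{n,1}, …, φ_{n,n} be real random variables on a probability space and let θ0 ∈ ℝ. Define ξ_{n,t} := φ_{n,t} − θ0, S_n := Σ_{t=1}^n ξ_{n,t}, Q_n := Σ_{t=1}^n ξ_{n,t}², θ̂_n := (1/n) Σ_{t=1}^n φ_{n,t}, and V̂_n := (1/(n−1)) Σ_{t=1}^n (φ_{n,t} − θ̂_n)². Suppose P(Q_n > 0) → 1 as n → ∞ and the self-normalized ratio is bounded in probability: for every δ > 0 there exists M < ∞ with limsup_n P(Q_n > 0 and |S_n|/√Q_n > M) ≤ δ. Then (n−1)·V̂_n / Q_n → 1 in probability as n → ∞ (the ratio being interpreted on the event {Q_n > 0}). In particular this holds whenever S_n/√Q_n converges in distribution to a standard Gaussian. -/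
open MeasureTheory Filter Topology

/-- Recentring a finite sum of squares at the sample mean. -/
theorem sum_sub_mean_sq {ι : Type*} (s : Finset ι) (hs : s.Nonempty) (x : ι → ℝ) (a : ℝ) :
    ∑ i ∈ s, (x i - (s.card : ℝ)⁻¹ * ∑ j ∈ s, x j) ^ 2 =
      ∑ i ∈ s, (x i - a) ^ 2 - (∑ i ∈ s, (x i - a)) ^ 2 / s.card := by
  have hc : (s.card : ℝ) ≠ 0 := by exact_mod_cast hs.card_pos.ne'
  simp only [sub_sq, Finset.sum_add_distrib, Finset.sum_sub_distrib, ← Finset.sum_mul,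
    ← Finset.mul_sum, Finset.sum_const, nsmul_eq_mul]
  field_simp
  ring

/-- A relative perturbation of `q` by `s ^ 2 / c` larger than `η` forces the self-normalized
ratio `|s| / √q` to be larger than any `M` with `M ^ 2 ≤ c * η`. -/
theorem lt_abs_div_sqrt_of_lt_abs_div_sub_one {s q c M η : ℝ} (hq : 0 < q) (hc : 0 < c)
    (hM : M ^ 2 ≤ c * η) (h : η < |(q - s ^ 2 / c) / q - 1|) : M < |s| / √q := by
  have hratio : (q - s ^ 2 / c) / q - 1 = -((|s| / √q) ^ 2 / c) := by
    rw [div_pow, sq_abs, Real.sq_sqrt hq.le]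
    field_simp
    ring
  rw [hratio, abs_neg, abs_of_nonneg (by positivity), lt_div_iff₀ hc, mul_comm] at h
  exact lt_of_pow_lt_pow_left₀ 2 (by positivity) (hM.trans_lt h)

/-- Proposition "feasibility of the studentizer".
For each `n ≥ 2`, let `φ_{n,1}, …, φ_{n,n}` be real random variables and `θ0 ∈ ℝ`. With
`ξ_{n,t} := φ_{n,t} − θ0`, `S_n := Σ_{t=1}^n ξ_{n,t}`, `Q_n := Σ_{t=1}^n ξ_{n,t}²`,
`θ̂_n := (1/n) Σ_{t=1}^n φ_{n,t}`, `V̂_n := (1/(n−1)) Σ_{t=1}^n (φ_{n,t} − θ̂_n)²`, if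
`P(Q_n > 0) → 1` and the self-normalized ratio is bounded in probability (for every `δ > 0`
there is `M` with `limsup_n P(Q_n > 0 ∧ |S_n|/√Q_n > M) ≤ δ`), then
`(n−1)·V̂_n / Q_n → 1` in probability, the ratio being interpreted on `{Q_n > 0}`
(with Lean's convention `x / 0 = 0` this is plain convergence in probability). -/
theorem studentizer_feasibility
    {Ω : Type*} {mΩ : MeasurableSpace Ω} {μ : Measure Ω} [IsProbabilityMeasure μ]
    (φ : ℕ → ℕ → Ω → ℝ) (hφmeas : ∀ n t, Measurable (φ n t)) (θ0 : ℝ)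
    (ξ : ℕ → ℕ → Ω → ℝ) (S Q θhat Vhat : ℕ → Ω → ℝ)
    (hξ : ξ = fun n t ω => φ n t ω - θ0)
    (hS : S = fun n ω => ∑ t ∈ Finset.Icc 1 n, ξ n t ω)
    (hQ : Q = fun n ω => ∑ t ∈ Finset.Icc 1 n, (ξ n t ω) ^ 2)
    (hθhat : θhat = fun (n : ℕ) (ω : Ω) => (n : ℝ)⁻¹ * ∑ t ∈ Finset.Icc 1 n, φ n t ω)
    (hVhat : Vhat = fun (n : ℕ) (ω : Ω) => ((n : ℝ) - 1)⁻¹ * ∑ t ∈ Finset.Icc 1 n, (φ n t ω - θhat n ω) ^ 2)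
    (hQpos : Tendsto (fun n => (μ {ω | 0 < Q n ω}).toReal) atTop (𝓝 1))
    (hbound : ∀ δ > (0 : ℝ), ∃ M : ℝ,
      limsup (fun n => (μ {ω | 0 < Q n ω ∧ M < |S n ω| / Real.sqrt (Q n ω)}).toReal) atTop ≤ δ) :
    ∀ η > (0 : ℝ),
      Tendsto (fun (n : ℕ) => (μ {ω | η < |((n : ℝ) - 1) * Vhat n ω / Q n ω - 1|}).toReal)
        atTop (𝓝 0) := by
  intro η hη
  have hQmeas : ∀ n, Measurable (Q n) := by
    intro n
    subst hQ hξ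
    fun_prop
  have hratio : ∀ n : ℕ, 2 ≤ n → ∀ ω,
      ((n : ℝ) - 1) * Vhat n ω = Q n ω - S n ω ^ 2 / n := by
    intro n hn ω
    have hn1 : (n : ℝ) - 1 ≠ 0 := by
      have : (2 : ℝ) ≤ n := by exact_mod_cast hn
      linarith
    have key := sum_sub_mean_sq (Finset.Icc 1 n) (Finset.nonempty_Icc.2 (by lia))
      (fun t => φ n t ω) θ0
    simp only [Nat.card_Icc, Nat.add_sub_cancel] at key
    subst hVhat hθhat hQ hS hξ
    simp only [mul_inv_cancel_left₀ hn1, key]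
  have hnonpos : ∀ n, μ.real {ω | Q n ω ≤ 0} = 1 - μ.real {ω | 0 < Q n ω} := by
    intro n
    rw [← probReal_compl_eq_one_sub (measurableSet_lt measurable_const (hQmeas n))]
    simp only [Set.compl_ofPred, not_lt]
  refine tendsto_order.2 ⟨fun a ha => .of_forall fun n => ha.trans_le ENNReal.toReal_nonneg,
    fun ε hε => ?_⟩
  obtain ⟨M, hM⟩ := hbound (ε / 3) (by positivity)
  have hlarge : ∀ᶠ n in atTop,
      μ.real {ω | 0 < Q n ω ∧ M < |S n ω| / √(Q n ω)} < ε / 2 :=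
    eventually_lt_of_limsup_lt (hM.trans_lt (by linarith))
      (isBoundedUnder_of ⟨1, fun _ => measureReal_le_one⟩)
  have hpos : ∀ᶠ n in atTop, 1 - ε / 2 < μ.real {ω | 0 < Q n ω} :=
    hQpos.eventually_const_lt (by linarith)
  have hn_large : ∀ᶠ n : ℕ in atTop, M ^ 2 ≤ n * η :=
    (tendsto_natCast_atTop_atTop.atTop_mul_const hη).eventually_ge_atTop _
  filter_upwards [hlarge, hpos, hn_large, eventually_ge_atTop 2] with n h1 h2 h3 h4
  have hsub : {ω | η < |((n : ℝ) - 1) * Vhat n ω / Q n ω - 1|} ⊆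
      {ω | Q n ω ≤ 0} ∪ {ω | 0 < Q n ω ∧ M < |S n ω| / √(Q n ω)} := by
    intro ω hω
    rw [Set.mem_ofPred_eq, hratio n h4] at hω
    rcases le_or_gt (Q n ω) 0 with hq | hq
    · exact Or.inl hq
    · exact Or.inr ⟨hq, lt_abs_div_sqrt_of_lt_abs_div_sub_one hq
        (by exact_mod_cast (by lia : 0 < n)) h3 hω⟩
  have hle := (measureReal_mono (μ := μ) hsub).trans (measureReal_union_le _ _)
  rw [hnonpos] at hle
  change μ.real _ < ε
  linarith
end

section
/- For each n ≥ 1, let (F_{n,t})_{0 ≤ t ≤ n} be a filtration on a probability space and let (ξ_{n,t})_{1 ≤ t ≤ n} be random variables such that ξ_{n,t} is F_{n,t}-measurable, E[ξ_{n,t} | F_{n,t−1}] = 0 almost surely, and sup_{n,t} E[ξ_{n,t}⁴] ≤ C for some finite constant C. Define V_n² := Σ_{t=1}^n E[ξ_{n,t}² | F_{n,t−1}] and Q_n := Σ_{t=1}^n ξ_{n,t}². Suppose there exists v > 0 such that P(V_n² ≥ v·n) → 1 as n → ∞. Then Q_n/V_n² → 1 in probability: for every η > 0, P(|Q_n − V_n²|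 > η·V_n²) → 0 as n → ∞. -/
open MeasureTheory ProbabilityTheory Filter Topology

section Orthogonality

variable {Ω : Type*} {m mΩ : MeasurableSpace Ω} {μ : Measure Ω}

/-- A square-integrable variable with vanishing conditional mean given `m` is orthogonal to every
`m`-measurable square-integrable variable. -/
lemma integral_mul_eq_zero_of_condExp_eq_zero [IsFiniteMeasure μ] (hm : m ≤ mΩ) {g D : Ω → ℝ}
    (hgm : StronglyMeasurable[m] g) (hg : MemLp g 2 μ) (hD : MemLp D 2 μ)
    (h0 : μ[D | m] =ᵐ[μ] 0) : ∫ ω, g ω * D ω ∂μ = 0 := by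
  have hpull : μ[g * D | m] =ᵐ[μ] g * μ[D | m] :=
    condExp_mul_of_stronglyMeasurable_left hgm (hg.integrable_mul hD)
      (hD.integrable one_le_two)
  have hzero : μ[g * D | m] =ᵐ[μ] 0 := by
    filter_upwards [hpull, h0] with ω h₁ h₂
    simp [h₁, h₂]
  calc ∫ ω, g ω * D ω ∂μ = ∫ ω, (μ[g * D | m]) ω ∂μ := (integral_condExp hm).symm
    _ = 0 := by rw [integral_congr_ae hzero]; simp

/-- Centering a square-integrable variable by a conditional mean gives conditional mean zero. -/
lemma condExp_sub_condExp_ae_eq_zero [IsFiniteMeasure μ] (hm : m ≤ mΩ) {f : Ω → ℝ}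
    (hf : Integrable f μ) : μ[f - μ[f | m] | m] =ᵐ[μ] 0 := by
  have h := condExp_sub hf (integrable_condExp (m := m) (f := f) (μ := μ)) m
  rw [condExp_of_stronglyMeasurable hm stronglyMeasurable_condExp integrable_condExp] at h
  simpa using h

/-- Centering by a conditional mean does not increase the second moment. -/
lemma integral_sub_condExp_sq_le [IsFiniteMeasure μ] (hm : m ≤ mΩ) {f : Ω → ℝ}
    (hf : MemLp f 2 μ) :
    ∫ ω, (f ω - (μ[f | m]) ω) ^ 2 ∂μ ≤ ∫ ω, f ω ^ 2 ∂μ := by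
  set g : Ω → ℝ := μ[f | m]
  have hg : MemLp g 2 μ := hf.condExp one_le_two
  have hD : MemLp (f - g) 2 μ := hf.sub hg
  have hgD : ∫ ω, g ω * (f - g) ω ∂μ = 0 :=
    integral_mul_eq_zero_of_condExp_eq_zero hm stronglyMeasurable_condExp hg hD
      (condExp_sub_condExp_ae_eq_zero hm (hf.integrable one_le_two))
  have hi : Integrable (fun ω => g ω * (f - g) ω) μ := hg.integrable_mul hD
  have hle : ∫ ω, ((f - g) ω ^ 2 + 2 * (g ω * (f - g) ω)) ∂μ ≤ ∫ ω, f ω ^ 2 ∂μ := by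
    refine integral_mono (hD.integrable_sq.add (hi.const_mul 2)) hf.integrable_sq fun ω => ?_
    simp only [Pi.sub_apply]
    nlinarith [sq_nonneg (g ω)]
  rw [integral_add hD.integrable_sq (hi.const_mul 2), integral_const_mul, hgD] at hle
  simpa using hle

/-- Pythagoras for finitely many pairwise orthogonal square-integrable variables. -/
lemma integral_sum_sq_of_orthogonal {ι : Type*} (s : Finset ι) {D : ι → Ω → ℝ}
    (hD : ∀ i ∈ s, MemLp (D i) 2 μ)
    (horth : ∀ i ∈ s, ∀ j ∈ s, i ≠ j → ∫ ω, D i ω * D j ω ∂μ = 0) :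
    ∫ ω, (∑ i ∈ s, D i ω) ^ 2 ∂μ = ∑ i ∈ s, ∫ ω, D i ω ^ 2 ∂μ := by
  have hi : ∀ i ∈ s, ∀ j ∈ s, Integrable (fun ω => D i ω * D j ω) μ :=
    fun i hi j hj => (hD i hi).integrable_mul (hD j hj)
  simp_rw [sq, Finset.sum_mul_sum]
  rw [integral_finsetSum s fun i his => integrable_finsetSum s (hi i his)]
  refine Finset.sum_congr rfl fun i his => ?_
  rw [integral_finsetSum s (hi i his)]
  exact Finset.sum_eq_single_of_mem i his fun j hjs hji => horth i his j hjs hji.symm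

/-- For an adapted square-integrable sequence, the second moment of the sum of the increments
`f t - E[f t | ℱ (t - 1)]` is bounded by the sum of the second moments of the `f t`. -/
lemma integral_sum_sub_condExp_sq_le [IsFiniteMeasure μ] (ℱ : Filtration ℕ mΩ) (n : ℕ)
    {f : ℕ → Ω → ℝ} (hfm : ∀ t ∈ Finset.Icc 1 n, StronglyMeasurable[ℱ t] (f t))
    (hf : ∀ t ∈ Finset.Icc 1 n, MemLp (f t) 2 μ) :
    ∫ ω, (∑ t ∈ Finset.Icc 1 n, (f t ω - (μ[f t | ℱ (t - 1)]) ω)) ^ 2 ∂μ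
      ≤ ∑ t ∈ Finset.Icc 1 n, ∫ ω, f t ω ^ 2 ∂μ := by
  set D : ℕ → Ω → ℝ := fun t => f t - μ[f t | ℱ (t - 1)] with hDdef
  have hD : ∀ t ∈ Finset.Icc 1 n, MemLp (D t) 2 μ :=
    fun t ht => (hf t ht).sub ((hf t ht).condExp one_le_two)
  have hlt : ∀ s ∈ Finset.Icc 1 n, ∀ t ∈ Finset.Icc 1 n, s < t →
      ∫ ω, D s ω * D t ω ∂μ = 0 := by
    intro s hs t ht hst
    refine integral_mul_eq_zero_of_condExp_eq_zero (ℱ.le (t - 1)) ?_ (hD s hs) (hD t ht)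
      (condExp_sub_condExp_ae_eq_zero (ℱ.le (t - 1)) ((hf t ht).integrable one_le_two))
    exact ((hfm s hs).mono (ℱ.mono (by omega))).sub
      (stronglyMeasurable_condExp.mono (ℱ.mono (by omega)))
  have horth : ∀ s ∈ Finset.Icc 1 n, ∀ t ∈ Finset.Icc 1 n, s ≠ t →
      ∫ ω, D s ω * D t ω ∂μ = 0 := by
    intro s hs t ht hst
    rcases hst.lt_or_gt with h | h
    · exact hlt s hs t ht h
    · simpa only [mul_comm] using hlt t ht s hs h
  calc ∫ ω, (∑ t ∈ Finset.Icc 1 n, D t ω) ^ 2 ∂μ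
      = ∑ t ∈ Finset.Icc 1 n, ∫ ω, D t ω ^ 2 ∂μ := integral_sum_sq_of_orthogonal _ hD horth
    _ ≤ ∑ t ∈ Finset.Icc 1 n, ∫ ω, f t ω ^ 2 ∂μ :=
      Finset.sum_le_sum fun t ht => integral_sub_condExp_sq_le (ℱ.le (t - 1)) (hf t ht)

/-- Chebyshev's inequality for a real square-integrable variable, without centering. -/
lemma measureReal_le_abs_le_integral_sq_div {X : Ω → ℝ}
    (hX : MemLp X 2 μ) {c : ℝ} (hc : 0 < c) :
    μ.real {ω | c ≤ |X ω|} ≤ (∫ ω, X ω ^ 2 ∂μ) / c ^ 2 := by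
  have h := mul_meas_ge_le_integral_of_nonneg (μ := μ) (f := fun ω => X ω ^ 2)
    (ae_of_all _ fun ω => sq_nonneg (X ω)) hX.integrable_sq (c ^ 2)
  have hset : {ω | c ≤ |X ω|} = {ω | c ^ 2 ≤ X ω ^ 2} := by
    ext ω
    simp only [Set.mem_ofPred_eq]
    rw [sq_le_sq, abs_of_pos hc]
  rw [hset, le_div_iff₀ (by positivity), mul_comm]
  exact h

end Orthogonality

/-- realized vs. predictable quadratic variation.
For each `n ≥ 1` let `(F_{n,t})_{0 ≤ t ≤ n}` be a filtration and `(ξ_{n,t})_{1 ≤ t ≤ n}` a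
martingale difference array with `sup_{n,t} E[ξ_{n,t}⁴] ≤ C`. With
`V_n² := Σ E[ξ_{n,t}² | F_{n,t−1}]` and `Q_n := Σ ξ_{n,t}²`, if there is `v > 0` with
`P(V_n² ≥ v·n) → 1`, then `Q_n/V_n² → 1` in probability:
for every `η > 0`, `P(|Q_n − V_n²| > η·V_n²) → 0`. -/
theorem quadratic_variation_ratio
    {Ω : Type*} {mΩ : MeasurableSpace Ω} {μ : Measure Ω} [IsProbabilityMeasure μ]
    (F : ℕ → Filtration ℕ mΩ)
    (ξ : ℕ → ℕ → Ω → ℝ)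
    (hmeas : ∀ n, ∀ t ∈ Finset.Icc 1 n, StronglyMeasurable[F n t] (ξ n t))
    (hint : ∀ n, ∀ t ∈ Finset.Icc 1 n, Integrable (ξ n t) μ)
    (hmds : ∀ n, ∀ t ∈ Finset.Icc 1 n, μ[ξ n t | F n (t - 1)] =ᵐ[μ] 0)
    (C : ℝ)
    (hmom4 : ∀ n, ∀ t ∈ Finset.Icc 1 n, Integrable (fun ω => (ξ n t ω) ^ 4) μ)
    (hmom4bd : ∀ n, ∀ t ∈ Finset.Icc 1 n, ∫ ω, (ξ n t ω) ^ 4 ∂μ ≤ C)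
    (Vsq Q : ℕ → Ω → ℝ)
    (hVsq : Vsq = fun (n : ℕ) (ω : Ω) =>
      ∑ t ∈ Finset.Icc 1 n, (μ[fun ω' => (ξ n t ω') ^ 2 | F n (t - 1)]) ω)
    (hQ : Q = fun (n : ℕ) (ω : Ω) => ∑ t ∈ Finset.Icc 1 n, (ξ n t ω) ^ 2)
    (v : ℝ) (hv : 0 < v)
    (hVgrowth : Tendsto (fun (n : ℕ) => (μ {ω | v * n ≤ Vsq n ω}).toReal) atTop (𝓝 1)) :
    ∀ η > (0 : ℝ),
      Tendsto (fun n => (μ {ω | η * Vsq n ω < |Q n ω - Vsq n ω|}).toReal) atTop (𝓝 0) := by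
  intro η hη
  have hmemsq : ∀ n, ∀ t ∈ Finset.Icc 1 n, MemLp (fun ω => ξ n t ω ^ 2) 2 μ := by
    intro n t ht
    refine (memLp_two_iff_integrable_sq ((hint n t ht).aestronglyMeasurable.pow 2)).2 ?_
    simpa only [Pi.pow_apply, ← pow_mul] using hmom4 n t ht
  have hdiff : ∀ n ω, Q n ω - Vsq n ω = ∑ t ∈ Finset.Icc 1 n,
      (ξ n t ω ^ 2 - (μ[fun ω' => ξ n t ω' ^ 2 | F n (t - 1)]) ω) := by
    intro n ω
    rw [hQ, hVsq, Finset.sum_sub_distrib]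
  have hmemdiff : ∀ n, MemLp (fun ω => Q n ω - Vsq n ω) 2 μ := by
    intro n
    simp_rw [hdiff]
    exact memLp_finsetSum _ fun t ht =>
      (hmemsq n t ht).sub ((hmemsq n t ht).condExp one_le_two)
  have hsecond : ∀ n : ℕ, ∫ ω, (Q n ω - Vsq n ω) ^ 2 ∂μ ≤ n * C := by
    intro n
    simp_rw [hdiff]
    calc _ ≤ ∑ t ∈ Finset.Icc 1 n, ∫ ω, (ξ n t ω ^ 2) ^ 2 ∂μ :=
          integral_sum_sub_condExp_sq_le (F n) n (fun t ht => (hmeas n t ht).pow 2) (hmemsq n)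
      _ ≤ ∑ _t ∈ Finset.Icc 1 n, C := by
          refine Finset.sum_le_sum fun t ht => ?_
          simpa only [← pow_mul] using hmom4bd n t ht
      _ = n * C := by simp
  have hVmeas : ∀ n, Measurable (Vsq n) := by
    intro n
    rw [hVsq]
    exact Finset.measurable_fun_sum _ fun t _ =>
      (stronglyMeasurable_condExp.mono ((F n).le (t - 1))).measurable
  have hbound : ∀ n : ℕ, 1 ≤ n → (μ {ω | η * Vsq n ω < |Q n ω - Vsq n ω|}).toReal
      ≤ (1 - (μ {ω | v * n ≤ Vsq n ω}).toReal) + C / (η * v) ^ 2 / n := by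
    intro n hn
    have hn0 : (0 : ℝ) < n := by exact_mod_cast hn
    have hsub : {ω | η * Vsq n ω < |Q n ω - Vsq n ω|} ⊆
        {ω | v * n ≤ Vsq n ω}ᶜ ∪ {ω | η * v * n ≤ |Q n ω - Vsq n ω|} := by
      intro ω hω
      by_cases hV : v * n ≤ Vsq n ω
      · right
        have := mul_le_mul_of_nonneg_left hV hη.le
        simp only [Set.mem_ofPred_eq] at hω ⊢
        linarith
      · exact Or.inl hV
    calc μ.real {ω | η * Vsq n ω < |Q n ω - Vsq n ω|}
        ≤ μ.real {ω | v * n ≤ Vsq n ω}ᶜ + μ.real {ω | η * v * n ≤ |Q n ω - Vsq n ω|} :=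
          (measureReal_mono hsub).trans (measureReal_union_le _ _)
      _ ≤ (1 - μ.real {ω | v * n ≤ Vsq n ω}) + n * C / (η * v * n) ^ 2 := by
          refine add_le_add (probReal_compl_eq_one_sub
            (measurableSet_le measurable_const (hVmeas n))).le ?_
          refine (measureReal_le_abs_le_integral_sq_div (hmemdiff n) (by positivity)).trans ?_
          gcongr
          exact hsecond n
      _ = (1 - μ.real {ω | v * n ≤ Vsq n ω}) + C / (η * v) ^ 2 / n := by
          congr 1
          field_simp
  have hlim : Tendsto (fun n : ℕ => (1 - (μ {ω | v * n ≤ Vsq n ω}).toReal)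
      + C / (η * v) ^ 2 / n) atTop (𝓝 0) := by
    simpa using (hVgrowth.const_sub 1).add (tendsto_const_div_atTop_nhds_zero_nat (C / (η * v) ^ 2))
  exact squeeze_zero' (Eventually.of_forall fun _ => ENNReal.toReal_nonneg)
    ((eventually_ge_atTop 1).mono hbound) hlim
end

section
/- For each n ≥ 2, let (F_{n,t})_{0 ≤ t ≤ n} be a filtration and (ξ_{n,t})_{1 ≤ t ≤ n} a martingale difference array with sup_{n,t} E[ξ_{n,t}⁴] ≤ C < ∞. Define S_n := Σ_{t=1}^n ξ_{n,t} and V_n² := Σ_{t=1}^n E[ξ_{n,t}² | F_{n,t−1}], and suppose there are constants v > 0 with P(V_n² ≥ v·n) → 1 and V ∈ (0, ∞) with V_n²/n → V in probability. Fix θ0 ∈ ℝ and set φ_{n,t} := ξ_{n,t} + θ0, θ̂_n := (1/n) Σ_{t=1}^n φ_{n,t}, and V̂_n := (1/(n−1)) Σ_{t=1}^n (φ_{n,t} − θ̂_n)². Then √n·(θ̂_n − θ0) converges in distribution to the Gaussian law N(0, V), and V̂_n → V in probability. -/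
open MeasureTheory ProbabilityTheory Filter Topology

lemma norm_cexp_mul_I_sub_taylor_two_le (x : ℝ) :
    ‖Complex.exp (x * Complex.I) - 1 - x * Complex.I + (x : ℂ) ^ 2 / 2‖ ≤ 4 * |x| ^ 3 := by
  have hx : ‖(x * Complex.I : ℂ)‖ = |x| := by simp
  rcases le_total |x| 1 with h | h
  · have := Complex.exp_bound (x := x * Complex.I) (by rw [hx]; exact h) (n := 3) (by norm_num)
    rw [hx] at this
    have e : Complex.exp (x * Complex.I) - 1 - x * Complex.I + (x : ℂ) ^ 2 / 2 =
        Complex.exp (x * Complex.I) -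
          ∑ m ∈ Finset.range 3, (x * Complex.I : ℂ) ^ m / (m.factorial : ℂ) := by
      simp [Finset.sum_range_succ, mul_pow]
      ring
    rw [e]
    refine this.trans ?_
    have : 0 ≤ |x| ^ 3 := by positivity
    norm_num [Nat.factorial]
    linarith
  · have h1 : ‖Complex.exp (x * Complex.I) - 1 - x * Complex.I + (x : ℂ) ^ 2 / 2‖ ≤
        1 + 1 + |x| + |x| ^ 2 / 2 := by
      refine (norm_add_le _ _).trans (add_le_add ((norm_sub_le _ _).trans (add_le_add
        ((norm_sub_le _ _).trans (add_le_add ?_ ?_)) hx.le)) ?_)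
      · rw [Complex.norm_exp_ofReal_mul_I]
      · simp
      · simp
    have h2 : |x| ≤ |x| ^ 3 := le_self_pow₀ h (by norm_num)
    have h3 : |x| ^ 2 ≤ |x| ^ 3 := pow_le_pow_right₀ h (by norm_num)
    linarith

lemma abs_exp_neg_sub_one_add_le {a : ℝ} (ha : 0 ≤ a) : |Real.exp (-a) - 1 + a| ≤ a ^ 2 := by
  rcases le_total a 1 with h | h
  · have := Real.abs_exp_sub_one_sub_id_le (x := -a) (by rwa [abs_neg, abs_of_nonneg ha])
    simpa using this
  · have h1 := Real.add_one_le_exp (-a)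
    have h2 : Real.exp (-a) ≤ 1 := Real.exp_le_one_iff.2 (by linarith)
    rw [abs_of_nonneg (by linarith)]
    nlinarith

section

variable {Ω : Type*} {m mΩ : MeasurableSpace Ω} {μ : Measure Ω} [IsProbabilityMeasure μ]

lemma integral_mul_condExp_of_bounded (hm : m ≤ mΩ) {G : Ω → ℂ} {Y : Ω → ℝ} {B : ℝ}
    (hG : StronglyMeasurable[m] G) (hGB : ∀ ω, ‖G ω‖ ≤ B) (hY : Integrable Y μ) :
    ∫ ω, G ω * (Y ω : ℂ) ∂μ = ∫ ω, G ω * ((μ[Y | m]) ω : ℂ) ∂μ := by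
  have hi : Integrable (Y • G) μ := by
    refine (hY.ofReal (𝕜 := ℂ)).bdd_mul (c := B) (hG.mono hm).aestronglyMeasurable
      (ae_of_all _ hGB) |>.congr (ae_of_all _ fun ω => ?_)
    simp [mul_comm]
  have h := condExp_smul_of_aestronglyMeasurable_right hY hi hG.aestronglyMeasurable
  have h2 := integral_condExp (μ := μ) hm (f := Y • G)
  rw [integral_congr_ae h] at h2
  simpa [mul_comm] using h2.symm

lemma integral_sq_condExp_le (hm : m ≤ mΩ) {Y : Ω → ℝ} (hY : MemLp Y 2 μ) :
    ∫ ω, (μ[Y | m]) ω ^ 2 ∂μ ≤ ∫ ω, Y ω ^ 2 ∂μ := by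
  have h := integral_mono_ae (integrable_condVar (X := Y) (m := m) (μ := μ)) integrable_condExp
    (condVar_ae_le_condExp_sq hm hY)
  have h0 : 0 ≤ ∫ ω, (Var[Y; μ | m]) ω ∂μ := by
    refine integral_nonneg_of_ae (condExp_nonneg (ae_of_all _ fun ω => ?_))
    exact sq_nonneg _
  have h1 := integral_congr_ae (condVar_ae_eq_condExp_sq_sub_sq_condExp hm hY)
  simp only [Pi.sub_apply, Pi.pow_apply] at h1
  rw [integral_sub integrable_condExp (hY.condExp one_le_two).integrable_sq,
    integral_condExp hm] at h1
  simp only [Pi.pow_apply] at h1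
  linarith [h1, h0]

lemma integral_sq_sub_condExp_le (hm : m ≤ mΩ) {Y : Ω → ℝ} (hY : MemLp Y 2 μ) :
    ∫ ω, (Y ω - (μ[Y | m]) ω) ^ 2 ∂μ ≤ ∫ ω, Y ω ^ 2 ∂μ := by
  have h := integral_mono_ae (integrable_condVar (X := Y) (m := m) (μ := μ)) integrable_condExp
    (condVar_ae_le_condExp_sq hm hY)
  rw [condVar, integral_condExp hm, integral_condExp hm] at h
  simpa using h

/-- One step of the martingale characteristic function comparison: conditionally on `m`, a centred
`X` with conditional variance `s` behaves like a Gaussian up to third and fourth moment errors. -/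
lemma norm_integral_mul_cexp_sub_le (hm : m ≤ mΩ) {G : Ω → ℂ} {X s : Ω → ℝ} {B : ℝ} (u : ℝ)
    (hG : StronglyMeasurable[m] G) (hGB : ∀ ω, ‖G ω‖ ≤ B) (hX : MemLp X 4 μ)
    (hXm : μ[X | m] =ᵐ[μ] 0) (hs : StronglyMeasurable[m] s) (hs0 : ∀ ω, 0 ≤ s ω)
    (hXs : μ[fun ω => X ω ^ 2 | m] =ᵐ[μ] s) :
    ‖∫ ω, G ω * (Complex.exp ((u * X ω : ℝ) * Complex.I) - Real.exp (-(u ^ 2 * s ω / 2))) ∂μ‖ ≤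
      B * (4 * |u| ^ 3 * ∫ ω, |X ω| ^ 3 ∂μ + u ^ 4 / 4 * ∫ ω, X ω ^ 4 ∂μ) := by
  have hGm := (hG.mono hm).aestronglyMeasurable (μ := μ)
  have hsm := (hs.mono hm).aestronglyMeasurable (μ := μ)
  have hX1 : Integrable X μ := hX.integrable (by norm_num)
  have hX2 : Integrable (fun ω => X ω ^ 2) μ := (hX.mono_exponent (by norm_num)).integrable_sq
  have hX3 : Integrable (fun ω => |X ω| ^ 3) μ :=
    (hX.mono_exponent (p := (3 : ℕ)) (by norm_num)).integrable_norm_pow (by norm_num)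
  have hX4 : Integrable (fun ω => X ω ^ 4) μ := by
    have := MemLp.integrable_norm_pow (p := 4) (hf := hX) (by norm_num)
    refine this.congr (ae_of_all _ fun ω => ?_)
    simp only [Real.norm_eq_abs]
    exact Even.pow_abs (by decide) _
  have hX22 : MemLp (fun ω => X ω ^ 2) 2 μ := by
    rw [memLp_two_iff_integrable_sq hX2.aestronglyMeasurable]
    simpa [← pow_mul] using hX4
  have hs1 : Integrable s μ := integrable_condExp.congr hXs
  have hs2 : Integrable (fun ω => s ω ^ 2) μ :=
    (hX22.condExp (m := m) one_le_two).integrable_sq.congr (hXs.mono fun ω h => by simp only [h])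
  have hB : 0 ≤ B := by
    obtain ⟨ω⟩ : Nonempty Ω := nonempty_of_isProbabilityMeasure μ
    exact (norm_nonneg _).trans (hGB ω)
  have hss : ∫ ω, s ω ^ 2 ∂μ ≤ ∫ ω, X ω ^ 4 ∂μ := by
    have := integral_sq_condExp_le hm hX22
    rw [integral_congr_ae (hXs.mono fun ω h => by simp only [h] :
      (fun ω => (μ[fun ω => X ω ^ 2 | m]) ω ^ 2) =ᵐ[μ] fun ω => s ω ^ 2)] at this
    simpa [← pow_mul] using this
  have hbd {Y : Ω → ℝ} (hY : Integrable Y μ) : Integrable (fun ω => G ω * (Y ω : ℂ)) μ :=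
    (hY.ofReal (𝕜 := ℂ)).bdd_mul (c := B) hGm (ae_of_all _ hGB)
  have e1 : ∫ ω, G ω * (X ω : ℂ) ∂μ = 0 := by
    rw [integral_mul_condExp_of_bounded hm hG hGB hX1]
    refine integral_eq_zero_of_ae (hXm.mono fun ω h => ?_)
    simp [h]
  have e2 : ∫ ω, G ω * ((X ω ^ 2 : ℝ) : ℂ) ∂μ = ∫ ω, G ω * (s ω : ℂ) ∂μ := by
    rw [integral_mul_condExp_of_bounded hm hG hGB hX2]
    exact integral_congr_ae (hXs.mono fun ω h => by simp only [h])
  set R : Ω → ℂ := fun ω => G ω * ((Complex.exp ((u * X ω : ℝ) * Complex.I) - 1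
    - (u * X ω : ℝ) * Complex.I + ((u * X ω : ℝ) : ℂ) ^ 2 / 2) -
    ((Real.exp (-(u ^ 2 * s ω / 2)) - 1 + u ^ 2 * s ω / 2 : ℝ) : ℂ)) with hR
  have hRle (ω) : ‖R ω‖ ≤ B * (4 * |u| ^ 3 * |X ω| ^ 3 + u ^ 4 / 4 * s ω ^ 2) := by
    rw [hR, norm_mul]
    refine mul_le_mul (hGB ω) ((norm_sub_le _ _).trans (add_le_add
      ((norm_cexp_mul_I_sub_taylor_two_le _).trans_eq ?_) ?_)) (norm_nonneg _) hB
    · rw [abs_mul, mul_pow]; ring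
    · rw [Complex.norm_real, Real.norm_eq_abs]
      have := hs0 ω
      exact (abs_exp_neg_sub_one_add_le (by positivity)).trans_eq (by ring)
  have hRb : Integrable (fun ω => B * (4 * |u| ^ 3 * |X ω| ^ 3 + u ^ 4 / 4 * s ω ^ 2)) μ :=
    ((hX3.const_mul _).add (hs2.const_mul _)).const_mul _
  have hRi : Integrable R μ := by
    have hXm := hX.aestronglyMeasurable.aemeasurable
    have hsm := hsm.aemeasurable
    have hGm := hGm.aemeasurable
    refine hRb.mono' (AEMeasurable.aestronglyMeasurable ?_) (ae_of_all _ hRle)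
    rw [hR]
    fun_prop
  have key : ∫ ω, G ω * (Complex.exp ((u * X ω : ℝ) * Complex.I) -
      Real.exp (-(u ^ 2 * s ω / 2))) ∂μ = ∫ ω, R ω ∂μ := by
    have : (fun ω => G ω * (Complex.exp ((u * X ω : ℝ) * Complex.I) -
        Real.exp (-(u ^ 2 * s ω / 2)))) = fun ω => R ω + ((u * Complex.I) * (G ω * (X ω : ℂ)) -
        (u ^ 2 / 2 : ℂ) * (G ω * ((X ω ^ 2 : ℝ) : ℂ) - G ω * (s ω : ℂ))) := by
      ext ω
      simp only [hR]
      push_cast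
      ring
    have i1 := (hbd hX1).const_mul (u * Complex.I)
    have i2 : Integrable (fun ω => (u ^ 2 / 2 : ℂ) *
        (G ω * ((X ω ^ 2 : ℝ) : ℂ) - G ω * (s ω : ℂ))) μ :=
      ((hbd hX2).sub (hbd hs1)).const_mul _
    have i3 : Integrable (fun ω => (u * Complex.I) * (G ω * (X ω : ℂ)) - (u ^ 2 / 2 : ℂ) *
        (G ω * ((X ω ^ 2 : ℝ) : ℂ) - G ω * (s ω : ℂ))) μ := i1.sub i2
    rw [this, integral_add hRi i3, integral_sub i1 i2, integral_const_mul,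
      integral_const_mul, integral_sub (hbd hX2) (hbd hs1), e1, e2]
    simp
  rw [key]
  refine (norm_integral_le_of_norm_le hRb (ae_of_all _ hRle)).trans ?_
  rw [integral_const_mul, integral_add (hX3.const_mul _) (hs2.const_mul _), integral_const_mul,
    integral_const_mul]
  gcongr

lemma norm_integral_cexp_sum_sub_one_le {F : Filtration ℕ mΩ} {X s : ℕ → Ω → ℝ} {K : ℝ} (u : ℝ)
    (n : ℕ) (hXF : ∀ t < n, StronglyMeasurable[F (t + 1)] (X t)) (hX : ∀ t < n, MemLp (X t) 4 μ)
    (hXm : ∀ t < n, μ[X t | F t] =ᵐ[μ] 0) (hs : ∀ t < n, StronglyMeasurable[F t] (s t))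
    (hs0 : ∀ t < n, ∀ ω, 0 ≤ s t ω) (hsK : ∀ ω, ∑ t ∈ Finset.range n, s t ω ≤ K)
    (hXs : ∀ t < n, μ[fun ω => X t ω ^ 2 | F t] =ᵐ[μ] s t) :
    ‖∫ ω, Complex.exp ((u * ∑ t ∈ Finset.range n, X t ω : ℝ) * Complex.I) *
        Real.exp (u ^ 2 * (∑ t ∈ Finset.range n, s t ω) / 2) ∂μ - 1‖ ≤
      ∑ t ∈ Finset.range n, Real.exp (u ^ 2 * K / 2) *
        (4 * |u| ^ 3 * ∫ ω, |X t ω| ^ 3 ∂μ + u ^ 4 / 4 * ∫ ω, X t ω ^ 4 ∂μ) := by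
  induction n with
  | zero => simp
  | succ n ih =>
    have hlt {t : ℕ} (ht : t < n) : t < n + 1 := by omega
    have hn : n < n + 1 := n.lt_succ_self
    have hsK' (ω) : ∑ t ∈ Finset.range n, s t ω ≤ K := by
      refine le_trans ?_ (hsK ω)
      rw [Finset.sum_range_succ]
      linarith [hs0 n hn ω]
    have ih := ih (fun t ht => hXF t (hlt ht)) (fun t ht => hX t (hlt ht))
      (fun t ht => hXm t (hlt ht)) (fun t ht => hs t (hlt ht)) (fun t ht => hs0 t (hlt ht)) hsK'
      (fun t ht => hXs t (hlt ht))
    have hS : StronglyMeasurable[F n] (fun ω => ∑ t ∈ Finset.range n, X t ω) :=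
      Finset.stronglyMeasurable_fun_sum _ fun t ht => by
        have ht := Finset.mem_range.1 ht
        exact (hXF t (hlt ht)).mono (F.mono (by omega))
    have hW : StronglyMeasurable[F n] (fun ω => ∑ t ∈ Finset.range (n + 1), s t ω) :=
      Finset.stronglyMeasurable_fun_sum _ fun t ht => by
        have ht := Finset.mem_range.1 ht
        exact (hs t ht).mono (F.mono (by omega))
    set G : Ω → ℂ := fun ω => Complex.exp ((u * ∑ t ∈ Finset.range n, X t ω : ℝ) * Complex.I) *
        Real.exp (u ^ 2 * (∑ t ∈ Finset.range (n + 1), s t ω) / 2) with hGdef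
    have hG : StronglyMeasurable[F n] G := by
      have h1 : Continuous fun x : ℝ => Complex.exp ((u * x : ℝ) * Complex.I) := by fun_prop
      have h2 : Continuous fun x : ℝ => ((Real.exp (u ^ 2 * x / 2) : ℝ) : ℂ) := by fun_prop
      exact (h1.comp_stronglyMeasurable hS).mul (h2.comp_stronglyMeasurable hW)
    have hGB (ω) : ‖G ω‖ ≤ Real.exp (u ^ 2 * K / 2) := by
      rw [hGdef, norm_mul, Complex.norm_exp_ofReal_mul_I, one_mul, Complex.norm_real,
        Real.norm_eq_abs, Real.abs_exp]
      have := hsK ω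
      gcongr
    have hstep := norm_integral_mul_cexp_sub_le (F.le n) u hG hGB (hX n hn) (hXm n hn) (hs n hn)
      (hs0 n hn) (hXs n hn)
    have hGi : Integrable G μ :=
      (integrable_const (Real.exp (u ^ 2 * K / 2))).mono' (hG.mono (F.le n)).aestronglyMeasurable
        (ae_of_all _ hGB)
    have hX_m := (hX n hn).aestronglyMeasurable.aemeasurable
    have hs_m := ((hs n hn).mono (F.le n)).aestronglyMeasurable (μ := μ) |>.aemeasurable
    have i1 : Integrable (fun ω => G ω * Complex.exp ((u * X n ω : ℝ) * Complex.I)) μ := by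
      refine hGi.mul_bdd (c := 1) (AEMeasurable.aestronglyMeasurable (by fun_prop))
        (ae_of_all _ fun ω => ?_)
      rw [Complex.norm_exp_ofReal_mul_I]
    have i2 : Integrable (fun ω => G ω * (Real.exp (-(u ^ 2 * s n ω / 2)) : ℂ)) μ := by
      refine hGi.mul_bdd (c := 1) (AEMeasurable.aestronglyMeasurable (by fun_prop))
        (ae_of_all _ fun ω => ?_)
      have := hs0 n hn ω
      rw [Complex.norm_real, Real.norm_eq_abs, Real.abs_exp, Real.exp_le_one_iff]
      have : 0 ≤ u ^ 2 * s n ω / 2 := by positivity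
      linarith
    have e1 : (fun ω => Complex.exp ((u * ∑ t ∈ Finset.range (n + 1), X t ω : ℝ) * Complex.I) *
        Real.exp (u ^ 2 * (∑ t ∈ Finset.range (n + 1), s t ω) / 2)) =
        fun ω => G ω * Complex.exp ((u * X n ω : ℝ) * Complex.I) := by
      ext ω
      rw [hGdef, Finset.sum_range_succ (fun t => X t ω), mul_add, Complex.ofReal_add, add_mul,
        Complex.exp_add]
      ring
    have e2 : (fun ω => Complex.exp ((u * ∑ t ∈ Finset.range n, X t ω : ℝ) * Complex.I) *
        Real.exp (u ^ 2 * (∑ t ∈ Finset.range n, s t ω) / 2)) =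
        fun ω => G ω * (Real.exp (-(u ^ 2 * s n ω / 2)) : ℂ) := by
      ext ω
      rw [hGdef, mul_assoc, ← Complex.ofReal_mul, ← Real.exp_add, Finset.sum_range_succ]
      ring_nf
    simp_rw [mul_sub] at hstep
    rw [integral_sub i1 i2] at hstep
    rw [e2] at ih
    rw [e1, Finset.sum_range_succ, add_comm (Finset.sum _ _)]
    refine le_trans (le_of_eq ?_) ((norm_add_le _ _).trans (add_le_add hstep ih))
    congr 1
    ring

end

section

variable {Ω : Type*} {m mΩ : MeasurableSpace Ω} {μ : Measure Ω} [IsProbabilityMeasure μ]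

lemma integral_sq_sum_eq_of_condExp_eq_zero {F : Filtration ℕ mΩ} {D : ℕ → Ω → ℝ} (n : ℕ)
    (hDF : ∀ t < n, StronglyMeasurable[F (t + 1)] (D t)) (hD : ∀ t < n, MemLp (D t) 2 μ)
    (hDm : ∀ t < n, μ[D t | F t] =ᵐ[μ] 0) :
    ∫ ω, (∑ t ∈ Finset.range n, D t ω) ^ 2 ∂μ = ∑ t ∈ Finset.range n, ∫ ω, D t ω ^ 2 ∂μ := by
  induction n with
  | zero => simp
  | succ n ih =>
    have hlt {t : ℕ} (ht : t < n) : t < n + 1 := by omega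
    have hn : n < n + 1 := n.lt_succ_self
    have ih := ih (fun t ht => hDF t (hlt ht)) (fun t ht => hD t (hlt ht))
      (fun t ht => hDm t (hlt ht))
    have hS : StronglyMeasurable[F n] (fun ω => ∑ t ∈ Finset.range n, D t ω) :=
      Finset.stronglyMeasurable_fun_sum _ fun t ht => by
        have ht := Finset.mem_range.1 ht
        exact (hDF t (hlt ht)).mono (F.mono (by omega))
    have hS2 : MemLp (fun ω => ∑ t ∈ Finset.range n, D t ω) 2 μ :=
      memLp_finsetSum _ fun t ht => hD t (hlt (Finset.mem_range.1 ht))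
    have hi : Integrable ((fun ω => ∑ t ∈ Finset.range n, D t ω) * D n) μ :=
      hS2.integrable_mul (hD n hn)
    have hcross : ∫ ω, (∑ t ∈ Finset.range n, D t ω) * D n ω ∂μ = 0 := by
      have h := condExp_mul_of_stronglyMeasurable_left hS hi ((hD n hn).integrable one_le_two)
      have h2 := integral_condExp (μ := μ) (F.le n)
        (f := (fun ω => ∑ t ∈ Finset.range n, D t ω) * D n)
      rw [integral_congr_ae h] at h2
      refine h2.symm.trans (integral_eq_zero_of_ae ((hDm n hn).mono fun ω h => ?_))
      simp [h]
    have e : (fun ω => (∑ t ∈ Finset.range (n + 1), D t ω) ^ 2) = fun ω =>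
        (∑ t ∈ Finset.range n, D t ω) ^ 2 +
          (2 * ((∑ t ∈ Finset.range n, D t ω) * D n ω) + D n ω ^ 2) := by
      ext ω
      rw [Finset.sum_range_succ]
      ring
    have i1 : Integrable (fun ω => 2 * ((∑ t ∈ Finset.range n, D t ω) * D n ω)) μ :=
      hi.const_mul 2
    have i2 : Integrable (fun ω => 2 * ((∑ t ∈ Finset.range n, D t ω) * D n ω) + D n ω ^ 2) μ :=
      i1.add (hD n hn).integrable_sq
    rw [e, integral_add hS2.integrable_sq i2, integral_add i1 (hD n hn).integrable_sq,
      integral_const_mul, hcross, ih, Finset.sum_range_succ]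
    ring

/-- Stopping the increments `s` as soon as their partial sums exceed `K` keeps the partial sums
below `K`. -/
lemma sum_ite_partialSum_le {K : ℝ} (hK : 0 ≤ K) {s : ℕ → ℝ} (hs : ∀ t, 0 ≤ s t) (n : ℕ) :
    ∑ t ∈ Finset.range n, (if ∑ i ∈ Finset.range (t + 1), s i ≤ K then s t else 0) ≤ K := by
  by_cases h : ∑ i ∈ Finset.range n, s i ≤ K
  · refine le_trans (Finset.sum_le_sum fun t _ => ?_) h
    split_ifs
    exacts [le_rfl, hs t]
  · induction n with
    | zero => simpa using hK
    | succ n ih =>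
      rw [Finset.sum_range_succ, if_neg h, add_zero]
      by_cases h' : ∑ i ∈ Finset.range n, s i ≤ K
      · refine le_trans (Finset.sum_le_sum fun t _ => ?_) h'
        split_ifs
        exacts [le_rfl, hs t]
      · exact ih h'

lemma norm_integral_cexp_sum_sub_exp_le {F : Filtration ℕ mΩ} {X : ℕ → Ω → ℝ} {V η : ℝ} (u : ℝ)
    (n : ℕ) (hXF : ∀ t < n, StronglyMeasurable[F (t + 1)] (X t)) (hX : ∀ t < n, MemLp (X t) 4 μ)
    (hXm : ∀ t < n, μ[X t | F t] =ᵐ[μ] 0) (hV : 0 ≤ V) (hη0 : 0 ≤ η) (hη : η ≤ 1) :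
    ‖∫ ω, Complex.exp ((u * ∑ t ∈ Finset.range n, X t ω : ℝ) * Complex.I) ∂μ -
        Real.exp (-(u ^ 2 * V / 2))‖ ≤
      (Real.exp (u ^ 2 * η / 2) - 1) + (1 + Real.exp (u ^ 2 / 2)) *
        μ.real {ω | η < |∑ t ∈ Finset.range n, (μ[fun ω' => X t ω' ^ 2 | F t]) ω - V|} +
      ∑ t ∈ Finset.range n, Real.exp (u ^ 2 * (V + 1) / 2) *
        (4 * |u| ^ 3 * ∫ ω, |X t ω| ^ 3 ∂μ + u ^ 4 / 4 * ∫ ω, X t ω ^ 4 ∂μ) := by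
  set σ : ℕ → Ω → ℝ := fun t ω => max ((μ[fun ω' => X t ω' ^ 2 | F t]) ω) 0 with hσ
  have hσm (t) : StronglyMeasurable[F t] (σ t) :=
    (continuous_id.max continuous_const).comp_stronglyMeasurable stronglyMeasurable_condExp
  have hσ0 (t ω) : 0 ≤ σ t ω := le_max_right _ _
  have hσe (t) : μ[fun ω' => X t ω' ^ 2 | F t] =ᵐ[μ] σ t := by
    filter_upwards [condExp_nonneg (μ := μ) (m := F t) (f := fun ω' => X t ω' ^ 2)
      (ae_of_all _ fun ω => sq_nonneg _)] with ω h
    exact (max_eq_left h).symm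
  set W : ℕ → Ω → ℝ := fun k ω => ∑ t ∈ Finset.range k, σ t ω with hW
  have hWm (t) : StronglyMeasurable[F t] (W (t + 1)) :=
    Finset.stronglyMeasurable_fun_sum _ fun i hi => by
      have := Finset.mem_range.1 hi
      exact (hσm i).mono (F.mono (by omega))
  set A : ℕ → Set Ω := fun t => {ω | W (t + 1) ω ≤ V + 1} with hA
  have hAm (t) : MeasurableSet[F t] (A t) :=
    (hWm t).measurable measurableSet_Iic
  set X' : ℕ → Ω → ℝ := fun t => (A t).indicator (X t) with hX'
  set s : ℕ → Ω → ℝ := fun t => (A t).indicator (σ t) with hs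
  have hX'4 : ∀ t < n, MemLp (X' t) 4 μ := fun t ht => (hX t ht).indicator (F.le t _ (hAm t))
  have hX1 : ∀ t < n, Integrable (X t) μ := fun t ht => (hX t ht).integrable (by norm_num)
  have hsq : ∀ t < n, Integrable (fun ω => X t ω ^ 2) μ := fun t ht =>
    ((hX t ht).mono_exponent (by norm_num)).integrable_sq
  have hsK (ω) : ∑ t ∈ Finset.range n, s t ω ≤ V + 1 := by
    classical
    have := sum_ite_partialSum_le (K := V + 1) (by linarith) (fun t => hσ0 t ω) n
    refine le_trans (le_of_eq (Finset.sum_congr rfl fun t _ => ?_)) this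
    simp [hs, hA, Set.indicator_apply, hW]
  have main := norm_integral_cexp_sum_sub_one_le (μ := μ) (F := F) (X := X') (s := s)
    (K := V + 1) u n
    (fun t ht => (hXF t ht).indicator (F.mono (Nat.le_succ t) _ (hAm t))) hX'4
    (fun t ht => by
      refine (condExp_indicator (hX1 t ht) (hAm t)).trans ((hXm t ht).mono fun ω h => ?_)
      simp [Set.indicator_apply, h])
    (fun t ht => (hσm t).indicator (hAm t))
    (fun t ht ω => Set.indicator_nonneg (fun ω _ => hσ0 t ω) ω) hsK
    (fun t ht => by
      have e : (fun ω => X' t ω ^ 2) = (A t).indicator (fun ω => X t ω ^ 2) := by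
        ext ω
        by_cases h : ω ∈ A t <;> simp [hX', h]
      rw [e]
      refine (condExp_indicator (hsq t ht) (hAm t)).trans ((hσe t).mono fun ω h => ?_)
      by_cases h' : ω ∈ A t <;> simp [hs, h', h])
  set Z : Ω → ℂ := fun ω => Complex.exp ((u * ∑ t ∈ Finset.range n, X' t ω : ℝ) * Complex.I) *
        Real.exp (u ^ 2 * (∑ t ∈ Finset.range n, s t ω) / 2) with hZ
  set E : Ω → ℂ := fun ω => Complex.exp ((u * ∑ t ∈ Finset.range n, X t ω : ℝ) * Complex.I)
    with hE
  have hXmeas : ∀ t < n, AEMeasurable (X t) μ := fun t ht =>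
    (hX t ht).aestronglyMeasurable.aemeasurable
  have hX'meas : ∀ t < n, AEMeasurable (X' t) μ := fun t ht =>
    (hX'4 t ht).aestronglyMeasurable.aemeasurable
  have hsmeas : ∀ t < n, AEMeasurable (s t) μ := fun t ht =>
    (((hσm t).indicator (hAm t)).mono (F.le t)).aestronglyMeasurable.aemeasurable
  have hEi : Integrable E μ := by
    have : AEMeasurable (fun ω => ∑ t ∈ Finset.range n, X t ω) μ :=
      Finset.aemeasurable_fun_sum _ fun t ht => hXmeas t (Finset.mem_range.1 ht)
    refine (integrable_const (1 : ℝ)).mono' (AEMeasurable.aestronglyMeasurable (by fun_prop))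
      (ae_of_all _ fun ω => ?_)
    rw [hE, Complex.norm_exp_ofReal_mul_I]
  have hZi : Integrable Z μ := by
    have h1 : AEMeasurable (fun ω => ∑ t ∈ Finset.range n, X' t ω) μ :=
      Finset.aemeasurable_fun_sum _ fun t ht => hX'meas t (Finset.mem_range.1 ht)
    have h2 : AEMeasurable (fun ω => ∑ t ∈ Finset.range n, s t ω) μ :=
      Finset.aemeasurable_fun_sum _ fun t ht => hsmeas t (Finset.mem_range.1 ht)
    refine (integrable_const (Real.exp (u ^ 2 * (V + 1) / 2))).mono'
      (AEMeasurable.aestronglyMeasurable (by fun_prop)) (ae_of_all _ fun ω => ?_)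
    rw [hZ, norm_mul, Complex.norm_exp_ofReal_mul_I, one_mul, Complex.norm_real,
      Real.norm_eq_abs, Real.abs_exp]
    have := hsK ω
    gcongr
  set D : Set Ω := {ω | η < |∑ t ∈ Finset.range n, (μ[fun ω' => X t ω' ^ 2 | F t]) ω - V|}
    with hD
  have hDm : MeasurableSet D := by
    have : Measurable fun ω => ∑ t ∈ Finset.range n, (μ[fun ω' => X t ω' ^ 2 | F t]) ω :=
      Finset.measurable_fun_sum _ fun t _ =>
        (stronglyMeasurable_condExp.mono (F.le t)).measurable
    exact measurableSet_lt measurable_const (this.sub_const V).abs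
  have hVexp : Real.exp (-(u ^ 2 * V / 2)) ≤ 1 :=
    Real.exp_le_one_iff.2 (by have : 0 ≤ u ^ 2 * V / 2 := by positivity
                              linarith)
  have hZnorm (ω) : ‖(Real.exp (-(u ^ 2 * V / 2)) : ℂ) * Z ω‖ =
      Real.exp (u ^ 2 * (∑ t ∈ Finset.range n, s t ω - V) / 2) := by
    rw [hZ, norm_mul, norm_mul, Complex.norm_exp_ofReal_mul_I, one_mul, Complex.norm_real,
      Real.norm_eq_abs, Real.abs_exp, Complex.norm_real, Real.norm_eq_abs, Real.abs_exp,
      ← Real.exp_add]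
    ring_nf
  have hpt : ∀ᵐ ω ∂μ, ‖E ω - (Real.exp (-(u ^ 2 * V / 2)) : ℂ) * Z ω‖ ≤
      (Real.exp (u ^ 2 * η / 2) - 1) + (1 + Real.exp (u ^ 2 / 2)) * D.indicator 1 ω := by
    have hη1 : 0 ≤ Real.exp (u ^ 2 * η / 2) - 1 := sub_nonneg.2 (Real.one_le_exp (by positivity))
    filter_upwards [ae_all_iff.2 hσe] with ω hω
    by_cases h : ω ∈ D
    · rw [Set.indicator_of_mem h, Pi.one_apply, mul_one]
      refine le_add_of_nonneg_of_le hη1 ((norm_sub_le _ _).trans (add_le_add ?_ ?_))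
      · rw [hE, Complex.norm_exp_ofReal_mul_I]
      · rw [hZnorm]
        have := hsK ω
        refine Real.exp_le_exp.2 ?_
        have : ∑ t ∈ Finset.range n, s t ω - V ≤ 1 := by linarith
        have := mul_le_mul_of_nonneg_left this (sq_nonneg u)
        linarith
    · have hWV : |W n ω - V| ≤ η := by
        have : ¬ (η < |∑ t ∈ Finset.range n, (μ[fun ω' => X t ω' ^ 2 | F t]) ω - V|) := h
        rw [Finset.sum_congr rfl fun t _ => hω t] at this
        exact not_lt.1 this
      have hmem : ∀ t ∈ Finset.range n, ω ∈ A t := fun t ht => by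
        have h1 : W (t + 1) ω ≤ W n ω :=
          Finset.sum_le_sum_of_subset_of_nonneg
            (Finset.range_subset_range.2 (Finset.mem_range.1 ht)) fun i _ _ => hσ0 i ω
        have h2 := (abs_le.1 hWV).2
        show W (t + 1) ω ≤ V + 1
        linarith
      have e1 : ∑ t ∈ Finset.range n, X' t ω = ∑ t ∈ Finset.range n, X t ω :=
        Finset.sum_congr rfl fun t ht => Set.indicator_of_mem (hmem t ht) _
      have e2 : ∑ t ∈ Finset.range n, s t ω = W n ω :=
        Finset.sum_congr rfl fun t ht => Set.indicator_of_mem (hmem t ht) _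
      rw [Set.indicator_of_notMem h, mul_zero, add_zero]
      have e3 : E ω - (Real.exp (-(u ^ 2 * V / 2)) : ℂ) * Z ω =
          E ω * ((1 - Real.exp (u ^ 2 * (W n ω - V) / 2) : ℝ) : ℂ) := by
        have : Real.exp (u ^ 2 * (W n ω - V) / 2) =
            Real.exp (-(u ^ 2 * V / 2)) * Real.exp (u ^ 2 * W n ω / 2) := by
          rw [← Real.exp_add]
          ring_nf
        rw [this]
        simp only [hZ, hE, e1, e2]
        push_cast
        ring
      rw [e3, norm_mul, hE, Complex.norm_exp_ofReal_mul_I, one_mul, Complex.norm_real,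
        Real.norm_eq_abs]
      obtain ⟨h1, h2⟩ := abs_le.1 hWV
      have h1 := mul_le_mul_of_nonneg_left h1 (sq_nonneg u)
      have h2 := mul_le_mul_of_nonneg_left h2 (sq_nonneg u)
      have hle : Real.exp (u ^ 2 * (W n ω - V) / 2) ≤ Real.exp (u ^ 2 * η / 2) :=
        Real.exp_le_exp.2 (by linarith)
      have hge : Real.exp (-(u ^ 2 * η / 2)) ≤ Real.exp (u ^ 2 * (W n ω - V) / 2) :=
        Real.exp_le_exp.2 (by linarith)
      have hinv : 2 ≤ Real.exp (u ^ 2 * η / 2) + Real.exp (-(u ^ 2 * η / 2)) := by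
        have := Real.one_le_cosh (u ^ 2 * η / 2)
        rw [Real.cosh_eq] at this
        linarith
      rw [abs_le]
      constructor <;> linarith
  have hmoments : ∀ t ∈ Finset.range n, Real.exp (u ^ 2 * (V + 1) / 2) *
      (4 * |u| ^ 3 * ∫ ω, |X' t ω| ^ 3 ∂μ + u ^ 4 / 4 * ∫ ω, X' t ω ^ 4 ∂μ) ≤
      Real.exp (u ^ 2 * (V + 1) / 2) *
      (4 * |u| ^ 3 * ∫ ω, |X t ω| ^ 3 ∂μ + u ^ 4 / 4 * ∫ ω, X t ω ^ 4 ∂μ) := fun t ht => by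
    have ht := Finset.mem_range.1 ht
    have h3 : Integrable (fun ω => |X t ω| ^ 3) μ :=
      ((hX t ht).mono_exponent (p := (3 : ℕ)) (by norm_num)).integrable_norm_pow (by norm_num)
    have h4 : Integrable (fun ω => X t ω ^ 4) μ := by
      refine (MemLp.integrable_norm_pow (p := 4) (hf := hX t ht) (by norm_num)).congr
        (ae_of_all _ fun ω => ?_)
      simp only [Real.norm_eq_abs]
      exact Even.pow_abs (by decide) _
    gcongr ?_ * (?_ * ?_ + ?_ * ?_)
    · refine integral_mono_of_nonneg (ae_of_all _ fun ω => by positivity) h3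
        (ae_of_all _ fun ω => ?_)
      by_cases h : ω ∈ A t <;> simp [hX', h]
    · refine integral_mono_of_nonneg (ae_of_all _ fun ω => by positivity) h4
        (ae_of_all _ fun ω => ?_)
      by_cases h : ω ∈ A t <;> simp [hX', h]
      positivity
  have hsplit : ∫ ω, E ω ∂μ - Real.exp (-(u ^ 2 * V / 2)) =
      ∫ ω, (E ω - (Real.exp (-(u ^ 2 * V / 2)) : ℂ) * Z ω) ∂μ +
        (Real.exp (-(u ^ 2 * V / 2)) : ℂ) * (∫ ω, Z ω ∂μ - 1) := by
    rw [integral_sub hEi (hZi.const_mul _), integral_const_mul]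
    ring
  have hDi : Integrable (D.indicator (1 : Ω → ℝ)) μ :=
    (integrable_const (1 : ℝ)).indicator hDm
  rw [hsplit]
  refine (norm_add_le _ _).trans (add_le_add ?_ ?_)
  · have hbound : Integrable (fun ω => (Real.exp (u ^ 2 * η / 2) - 1) +
        (1 + Real.exp (u ^ 2 / 2)) * D.indicator 1 ω) μ :=
      (integrable_const _).add (hDi.const_mul _)
    refine (norm_integral_le_of_norm_le hbound hpt).trans ?_
    rw [integral_add (integrable_const _) (hDi.const_mul _), integral_const_mul,
      integral_indicator_one hDm]
    simp
  · rw [norm_mul, Complex.norm_real, Real.norm_eq_abs, Real.abs_exp]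
    exact (mul_le_of_le_one_left (norm_nonneg _) hVexp).trans
      (main.trans (Finset.sum_le_sum hmoments))

end

lemma abs_pow_three_le_one_add_pow_four (x : ℝ) : |x| ^ 3 ≤ 1 + x ^ 4 := by
  rw [← (by decide : Even 4).pow_abs x]
  have h := abs_nonneg x
  rcases le_total |x| 1 with h1 | h1
  · nlinarith [pow_le_one₀ h h1 (n := 3), pow_nonneg h 4]
  · nlinarith [pow_nonneg h 3]

section
variable {Ω : Type*} {mΩ : MeasurableSpace Ω} {μ : Measure Ω}

lemma memLp_four_of_integrable_pow_four {X : Ω → ℝ} (hX : Measurable X)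
    (hX4 : Integrable (fun ω => X ω ^ 4) μ) : MemLp X 4 μ := by
  rw [← integrable_norm_rpow_iff hX.aestronglyMeasurable (by norm_num) (by norm_num)]
  refine hX4.congr (ae_of_all _ fun ω => ?_)
  have h : (4 : ENNReal).toReal = ((4 : ℕ) : ℝ) := by norm_num
  simp only [h, Real.rpow_natCast, Real.norm_eq_abs]
  exact ((by decide : Even 4).pow_abs _).symm

lemma memLp_two_sq_of_integrable_pow_four {X : Ω → ℝ} (hX : Measurable X)
    (hX4 : Integrable (fun ω => X ω ^ 4) μ) : MemLp (fun ω => X ω ^ 2) 2 μ := by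
  rw [memLp_two_iff_integrable_sq (hX.pow_const 2).aestronglyMeasurable]
  exact hX4.congr (ae_of_all _ fun ω => by ring)

variable [IsProbabilityMeasure μ]

/-- The characteristic function of a normalized martingale sum is quantitatively close to that of
`N(0, V)` when the normalized conditional variance is close to `V`. -/
lemma norm_integral_cexp_normalized_sum_sub_exp_le {F : Filtration ℕ mΩ} {Y : ℕ → Ω → ℝ}
    {V η C : ℝ} (u : ℝ) {n : ℕ} (hn : 0 < n) (hYm : ∀ t < n, Measurable (Y t))
    (hYF : ∀ t < n, StronglyMeasurable[F (t + 1)] (Y t))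
    (hY4 : ∀ t < n, Integrable (fun ω => Y t ω ^ 4) μ)
    (hYC : ∀ t < n, ∫ ω, Y t ω ^ 4 ∂μ ≤ C)
    (hY0 : ∀ t < n, μ[Y t | F t] =ᵐ[μ] 0) (hV : 0 ≤ V) (hη0 : 0 ≤ η) (hη : η ≤ 1) :
    ‖∫ ω, Complex.exp ((u * ((√n)⁻¹ * ∑ t ∈ Finset.range n, Y t ω) : ℝ) * Complex.I) ∂μ
        - Real.exp (-(u ^ 2 * V / 2))‖
      ≤ (Real.exp (u ^ 2 * η / 2) - 1) + (1 + Real.exp (u ^ 2 / 2)) * μ.real {ω | η <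
          |(∑ t ∈ Finset.range n, (μ[fun ω' => Y t ω' ^ 2 | F t]) ω) / n - V|}
        + Real.exp (u ^ 2 * (V + 1) / 2) *
          (4 * |u| ^ 3 * (1 + C) * (√n)⁻¹ + u ^ 4 / 4 * C * (n : ℝ)⁻¹) := by
  have hn' : (0 : ℝ) < n := by exact_mod_cast hn
  have hs : (0 : ℝ) < √n := Real.sqrt_pos.2 hn'
  have hs2 : (√n) ^ 2 = (n : ℝ) := Real.sq_sqrt hn'.le
  have hX : ∀ t < n, MemLp (fun ω => (√n)⁻¹ * Y t ω) 4 μ := fun t ht =>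
    (memLp_four_of_integrable_pow_four (hYm t ht) (hY4 t ht)).const_mul _
  have key := norm_integral_cexp_sum_sub_exp_le (μ := μ) (F := F) (V := V) (η := η)
    (X := fun t ω => (√n)⁻¹ * Y t ω) u n
    (fun t ht => (hYF t ht).const_mul _) hX
    (fun t ht => by
      filter_upwards [condExp_smul (μ := μ) (√n)⁻¹ (Y t) (F t), hY0 t ht] with ω h1 h2
      have : (fun ω => (√n)⁻¹ * Y t ω) = (√n)⁻¹ • Y t := rfl
      rw [this, h1]; simp [h2]) hV hη0 hη
  have hcond : ∀ᵐ ω ∂μ, ∀ t ∈ Finset.range n,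
      (μ[fun ω' => ((√n)⁻¹ * Y t ω') ^ 2 | F t]) ω
        = (n : ℝ)⁻¹ * (μ[fun ω' => Y t ω' ^ 2 | F t]) ω := by
    rw [Filter.eventually_all_finset]
    intro t _
    filter_upwards [condExp_smul (μ := μ) (n : ℝ)⁻¹ (fun ω' => Y t ω' ^ 2) (F t)] with ω h1
    have : (fun ω' => ((√n)⁻¹ * Y t ω') ^ 2) = (n : ℝ)⁻¹ • fun ω' => Y t ω' ^ 2 := by
      ext ω'; simp [mul_pow, hs2]
    rw [this, h1]; simp
  have hset : μ.real {ω | η < |∑ t ∈ Finset.range n,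
      (μ[fun ω' => ((√n)⁻¹ * Y t ω') ^ 2 | F t]) ω - V|} = μ.real {ω | η <
          |(∑ t ∈ Finset.range n, (μ[fun ω' => Y t ω' ^ 2 | F t]) ω) / n - V|} := by
    refine measureReal_congr ?_
    filter_upwards [hcond] with ω h
    refine propext ?_
    change η < _ ↔ η < _
    rw [Finset.sum_congr rfl h, ← Finset.mul_sum, div_eq_inv_mul]
  have h3 : ∀ t ∈ Finset.range n, ∫ ω, |(√n)⁻¹ * Y t ω| ^ 3 ∂μ ≤ (√n)⁻¹ ^ 3 * (1 + C) := by
    intro t ht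
    have ht := Finset.mem_range.1 ht
    calc ∫ ω, |(√n)⁻¹ * Y t ω| ^ 3 ∂μ ≤ ∫ ω, (√n)⁻¹ ^ 3 * (1 + Y t ω ^ 4) ∂μ := by
          refine integral_mono_of_nonneg (ae_of_all _ fun ω => by positivity)
            (((integrable_const 1).add (hY4 t ht)).const_mul _) (ae_of_all _ fun ω => ?_)
          simp only [abs_mul, mul_pow, abs_of_pos (inv_pos.2 hs)]
          gcongr
          exact abs_pow_three_le_one_add_pow_four _
      _ = (√n)⁻¹ ^ 3 * (1 + ∫ ω, Y t ω ^ 4 ∂μ) := by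
          rw [integral_const_mul, integral_add (integrable_const 1) (hY4 t ht)]; simp
      _ ≤ _ := by gcongr; exact hYC t ht
  have h4 : ∀ t ∈ Finset.range n, ∫ ω, ((√n)⁻¹ * Y t ω) ^ 4 ∂μ ≤ (√n)⁻¹ ^ 4 * C := by
    intro t ht
    simp_rw [mul_pow]
    rw [integral_const_mul]
    gcongr
    exact hYC t (Finset.mem_range.1 ht)
  simp_rw [← Finset.mul_sum] at key
  rw [hset] at key
  refine key.trans ?_
  gcongr (Real.exp _ - 1) + (1 + Real.exp _) * _ + ?_
  gcongr Real.exp _ * ?_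
  calc ∑ t ∈ Finset.range n, (4 * |u| ^ 3 * ∫ ω, |(√n)⁻¹ * Y t ω| ^ 3 ∂μ
          + u ^ 4 / 4 * ∫ ω, ((√n)⁻¹ * Y t ω) ^ 4 ∂μ)
      ≤ ∑ t ∈ Finset.range n, (4 * |u| ^ 3 * ((√n)⁻¹ ^ 3 * (1 + C))
          + u ^ 4 / 4 * ((√n)⁻¹ ^ 4 * C)) := by
        refine Finset.sum_le_sum fun t ht => ?_
        gcongr
        · exact h3 t ht
        · exact h4 t ht
    _ = _ := by
        rw [Finset.sum_const, Finset.card_range, nsmul_eq_mul]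
        have e1 : (n : ℝ) * (√n)⁻¹ ^ 2 = 1 := by rw [inv_pow, hs2]; field_simp
        have e2 : (n : ℝ)⁻¹ = (√n)⁻¹ ^ 2 := by rw [inv_pow, hs2]
        rw [e2]
        linear_combination (4 * |u| ^ 3 * (1 + C) * (√n)⁻¹ + u ^ 4 / 4 * C * (√n)⁻¹ ^ 2) * e1

/-- **Martingale central limit theorem** under bounded fourth moments. -/
theorem tendsto_charFun_normalized_martingale_sum {F : ℕ → Filtration ℕ mΩ}
    {Y : ℕ → ℕ → Ω → ℝ} {V C : ℝ} (hYm : ∀ n, ∀ t < n, Measurable (Y n t))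
    (hYF : ∀ n, ∀ t < n, StronglyMeasurable[F n (t + 1)] (Y n t))
    (hY4 : ∀ n, ∀ t < n, Integrable (fun ω => Y n t ω ^ 4) μ)
    (hYC : ∀ n, ∀ t < n, ∫ ω, Y n t ω ^ 4 ∂μ ≤ C)
    (hY0 : ∀ n, ∀ t < n, μ[Y n t | F n t] =ᵐ[μ] 0) (hV : 0 ≤ V)
    (hstab : ∀ η > (0 : ℝ), Tendsto (fun n : ℕ => μ.real {ω | η <
      |(∑ t ∈ Finset.range n, (μ[fun ω' => Y n t ω' ^ 2 | F n t]) ω) / n - V|}) atTop (𝓝 0))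
    (u : ℝ) :
    Tendsto (fun n : ℕ => ∫ ω, Complex.exp
        ((u * ((√n)⁻¹ * ∑ t ∈ Finset.range n, Y n t ω) : ℝ) * Complex.I) ∂μ)
      atTop (𝓝 (Real.exp (-(u ^ 2 * V / 2)) : ℝ)) := by
  rw [tendsto_iff_norm_sub_tendsto_zero]
  have hsq : Tendsto (fun n : ℕ => (√(n : ℝ))⁻¹) atTop (𝓝 0) :=
    tendsto_inv_atTop_zero.comp (Real.tendsto_sqrt_atTop.comp tendsto_natCast_atTop_atTop)
  have hinv : Tendsto (fun n : ℕ => ((n : ℝ))⁻¹) atTop (𝓝 0) := tendsto_inv_atTop_nhds_zero_nat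
  refine Metric.tendsto_nhds.2 fun ε hε => ?_
  have hexp : Tendsto (fun η : ℝ => Real.exp (u ^ 2 * η / 2) - 1) (𝓝 0) (𝓝 0) := by
    have : Continuous fun η : ℝ => Real.exp (u ^ 2 * η / 2) - 1 := by fun_prop
    simpa using this.tendsto 0
  obtain ⟨η, hηε, hη0, hη1⟩ : ∃ η : ℝ, Real.exp (u ^ 2 * η / 2) - 1 < ε / 2 ∧ 0 < η ∧ η ≤ 1 := by
    have h1 : ∀ᶠ η in 𝓝[>] (0 : ℝ), Real.exp (u ^ 2 * η / 2) - 1 < ε / 2 :=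
      (hexp.mono_left nhdsWithin_le_nhds).eventually_lt_const (by positivity)
    have h2 : ∀ᶠ η in 𝓝[>] (0 : ℝ), η ∈ Set.Ioc (0 : ℝ) 1 := Ioc_mem_nhdsGT one_pos
    obtain ⟨η, h1, h2⟩ := (h1.and h2).exists
    exact ⟨η, h1, h2.1, h2.2⟩
  have hrest : Tendsto (fun n : ℕ => (1 + Real.exp (u ^ 2 / 2)) * μ.real {ω | η <
      |(∑ t ∈ Finset.range n, (μ[fun ω' => Y n t ω' ^ 2 | F n t]) ω) / n - V|}
      + Real.exp (u ^ 2 * (V + 1) / 2) *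
        (4 * |u| ^ 3 * (1 + C) * (√n)⁻¹ + u ^ 4 / 4 * C * (n : ℝ)⁻¹)) atTop (𝓝 0) := by
    simpa using ((hstab η hη0).const_mul (1 + Real.exp (u ^ 2 / 2))).add
      (((hsq.const_mul (4 * |u| ^ 3 * (1 + C))).add
        (hinv.const_mul (u ^ 4 / 4 * C))).const_mul (Real.exp (u ^ 2 * (V + 1) / 2)))
  filter_upwards [hrest.eventually_lt_const (show (0 : ℝ) < ε / 2 by positivity),
    eventually_gt_atTop 0] with n h1 hn
  have h2 := norm_integral_cexp_normalized_sum_sub_exp_le (μ := μ) (η := η) u hn (hYm n) (hYF n)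
    (hY4 n) (hYC n) (hY0 n) hV hη0.le hη1
  rw [Real.dist_0_eq_abs, abs_of_nonneg (norm_nonneg _)]
  linarith

lemma tendsto_integral_of_tendsto_charFun {Z : ℕ → Ω → ℝ} {V : ℝ} (hV : 0 ≤ V)
    (hZ : ∀ n, Measurable (Z n))
    (h : ∀ u : ℝ, Tendsto (fun n => ∫ ω, Complex.exp ((u * Z n ω : ℝ) * Complex.I) ∂μ)
      atTop (𝓝 (Real.exp (-(u ^ 2 * V / 2)) : ℝ)))
    (f : BoundedContinuousFunction ℝ ℝ) :
    Tendsto (fun n => ∫ ω, f (Z n ω) ∂μ) atTop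
      (𝓝 (∫ x, f x ∂(gaussianReal 0 V.toNNReal))) := by
  let P : ℕ → ProbabilityMeasure ℝ := fun n =>
    ⟨μ.map (Z n), Measure.isProbabilityMeasure_map (hZ n).aemeasurable⟩
  let G : ProbabilityMeasure ℝ := ⟨gaussianReal 0 V.toNNReal, inferInstance⟩
  have hP : Tendsto P atTop (𝓝 G) := by
    refine ProbabilityMeasure.tendsto_iff_tendsto_charFun.2 fun u => ?_
    have hG : charFun (G : Measure ℝ) u = (Real.exp (-(u ^ 2 * V / 2)) : ℝ) := by
      change charFun (gaussianReal 0 V.toNNReal) u = _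
      rw [charFun_gaussianReal, Complex.ofReal_exp]
      have : ((V.toNNReal : ℝ) : ℂ) = V := by rw [Real.coe_toNNReal _ hV]
      rw [this]
      congr 1
      push_cast
      ring
    rw [hG]
    refine (h u).congr fun n => ?_
    change _ = charFun (μ.map (Z n)) u
    rw [charFun_apply_real, integral_map (hZ n).aemeasurable (by fun_prop)]
    simp
  have := ProbabilityMeasure.tendsto_iff_forall_integral_tendsto.1 hP f
  refine this.congr fun n => ?_
  change ∫ x, f x ∂(μ.map (Z n)) = _
  rw [integral_map (hZ n).aemeasurable f.continuous.aestronglyMeasurable]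

end

lemma sum_Icc_one_eq_sum_range {M : Type*} [AddCommMonoid M] (g : ℕ → M) (n : ℕ) :
    ∑ t ∈ Finset.Icc 1 n, g t = ∑ t ∈ Finset.range n, g (t + 1) := by
  induction n with
  | zero => simp
  | succ n ih => rw [Finset.sum_Icc_succ_top (by omega), ih, Finset.sum_range_succ]

lemma inv_mul_sum_range_add_const (y : ℕ → ℝ) (a : ℝ) {n : ℕ} (hn : 0 < n) :
    (n : ℝ)⁻¹ * ∑ s ∈ Finset.range n, (y s + a)
      = (n : ℝ)⁻¹ * (∑ s ∈ Finset.range n, y s) + a := by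
  have hn' : (n : ℝ) ≠ 0 := by positivity
  rw [Finset.sum_add_distrib, mul_add, Finset.sum_const, Finset.card_range, nsmul_eq_mul,
    inv_mul_cancel_left₀ hn']

/-- The sum of squared deviations of `y + a` in terms of the sums of `y` and `y ^ 2`. -/
lemma sum_range_sq_deviation_add_const (y : ℕ → ℝ) (a : ℝ) {n : ℕ} (hn : 0 < n) :
    ∑ t ∈ Finset.range n, (y t + a - (n : ℝ)⁻¹ * ∑ s ∈ Finset.range n, (y s + a)) ^ 2
      = ∑ t ∈ Finset.range n, y t ^ 2 - (∑ t ∈ Finset.range n, y t) ^ 2 / n := by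
  have hn' : (n : ℝ) ≠ 0 := by positivity
  rw [inv_mul_sum_range_add_const y a hn]
  set w := ∑ s ∈ Finset.range n, y s with hw
  have : ∀ t, (y t + a - ((n : ℝ)⁻¹ * w + a)) ^ 2
      = y t ^ 2 - 2 * ((n : ℝ)⁻¹ * w) * y t + ((n : ℝ)⁻¹ * w) ^ 2 := fun t => by ring
  simp_rw [this]
  rw [Finset.sum_add_distrib, Finset.sum_sub_distrib, ← Finset.mul_sum, ← hw]
  simp
  field_simp
  ring

lemma deviation_cases_of_lt_abs_sampleVariance_sub {n s w Q V η : ℝ} (hn : 2 ≤ n)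
    (hV0 : 0 ≤ V) (hV : V / (n - 1) ≤ η / 4) (h : η < |(n - 1)⁻¹ * (s - w ^ 2 / n) - V|) :
    (η / 8 * n) ^ 2 ≤ (s - Q) ^ 2 ∨ η / 8 * n ^ 2 ≤ w ^ 2 ∨ η / 8 < |Q / n - V| := by
  by_contra! hc
  obtain ⟨h1, h2, h3⟩ := hc
  have hn0 : 0 < n := by linarith
  have hn1 : 0 < n - 1 := by linarith
  have hη : 0 ≤ η / 8 := (abs_nonneg _).trans h3
  have h1' := abs_lt_of_sq_lt_sq' h1 (by positivity)
  have h2' : w ^ 2 / n < η / 8 * n := by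
    rw [div_lt_iff₀ hn0]; linarith
  have h2'' : 0 ≤ w ^ 2 / n := by positivity
  have h3' := abs_le.1 h3
  have hV' : V ≤ η / 4 * (n - 1) := by rwa [div_le_iff₀ hn1] at hV
  have e : (n - 1)⁻¹ * (s - w ^ 2 / n) - V
      = (n - 1)⁻¹ * ((s - Q) - w ^ 2 / n + n * (Q / n - V) + V) := by
    field_simp; ring
  rw [e, abs_mul, abs_of_pos (inv_pos.2 hn1), ← div_eq_inv_mul, lt_div_iff₀ hn1, lt_abs] at h
  have h4 : n * (Q / n - V) ≤ n * (η / 8) := by gcongr; exact h3'.2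
  have h5 : n * (-(η / 8)) ≤ n * (Q / n - V) := by gcongr; exact h3'.1
  rcases h with h | h
  · nlinarith [h1'.1, h1'.2]
  · nlinarith [h1'.1, h1'.2]

section
variable {Ω : Type*} {mΩ : MeasurableSpace Ω} {μ : Measure Ω}

lemma measureReal_le_div_of_integral_sq_le {Z : Ω → ℝ} {c K : ℝ} (hZ : MemLp Z 2 μ) (hc : 0 < c)
    (hK : ∫ ω, Z ω ^ 2 ∂μ ≤ K) : μ.real {ω | c ≤ Z ω ^ 2} ≤ K / c := by
  rw [le_div_iff₀ hc, mul_comm]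
  exact (mul_meas_ge_le_integral_of_nonneg (ae_of_all _ fun ω => sq_nonneg _)
    hZ.integrable_sq c).trans hK

variable [IsProbabilityMeasure μ]

lemma integral_sq_sum_sq_sub_condExp_le {F : Filtration ℕ mΩ} {Y : ℕ → Ω → ℝ} {C : ℝ} {n : ℕ}
    (hYm : ∀ t < n, Measurable (Y t))
    (hYF : ∀ t < n, StronglyMeasurable[F (t + 1)] (Y t))
    (hY4 : ∀ t < n, Integrable (fun ω => Y t ω ^ 4) μ)
    (hYC : ∀ t < n, ∫ ω, Y t ω ^ 4 ∂μ ≤ C) :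
    MemLp (fun ω => ∑ t ∈ Finset.range n, (Y t ω ^ 2 - (μ[fun ω' => Y t ω' ^ 2 | F t]) ω)) 2 μ ∧
    ∫ ω, (∑ t ∈ Finset.range n, (Y t ω ^ 2 - (μ[fun ω' => Y t ω' ^ 2 | F t]) ω)) ^ 2 ∂μ
      ≤ n * C := by
  have hY2 : ∀ t < n, MemLp (fun ω => Y t ω ^ 2) 2 μ := fun t ht =>
    memLp_two_sq_of_integrable_pow_four (hYm t ht) (hY4 t ht)
  have hD : ∀ t < n, MemLp
      (fun ω => Y t ω ^ 2 - (μ[fun ω' => Y t ω' ^ 2 | F t]) ω) 2 μ := fun t ht =>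
    (hY2 t ht).sub ((hY2 t ht).condExp one_le_two)
  refine ⟨memLp_finsetSum _ fun t ht => hD t (Finset.mem_range.1 ht), ?_⟩
  rw [integral_sq_sum_eq_of_condExp_eq_zero (F := F)
    (D := fun t ω => Y t ω ^ 2 - (μ[fun ω' => Y t ω' ^ 2 | F t]) ω) n
    (fun t ht => ((hYF t ht).pow 2).sub (stronglyMeasurable_condExp.mono (F.mono t.le_succ)))
    hD (fun t ht => ?_)]
  · calc _ ≤ ∑ t ∈ Finset.range n, C := by
          refine Finset.sum_le_sum fun t ht => ?_
          have ht := Finset.mem_range.1 ht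
          refine (integral_sq_sub_condExp_le (F.le t) (hY2 t ht)).trans
            (le_trans (le_of_eq ?_) (hYC t ht))
          exact integral_congr_ae (ae_of_all _ fun ω => by ring)
      _ = n * C := by simp
  · have h1 : Integrable (fun ω => Y t ω ^ 2) μ := (hY2 t ht).integrable one_le_two
    filter_upwards [condExp_sub h1 (integrable_condExp (m := F t) (f := fun ω => Y t ω ^ 2)) (F t),
      condExp_condExp_of_le (μ := μ) (f := fun ω => Y t ω ^ 2) (le_refl (F t)) (F.le t)]
      with ω h2 h3
    have : (fun ω => Y t ω ^ 2 - (μ[fun ω' => Y t ω' ^ 2 | F t]) ω)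
      = (fun ω => Y t ω ^ 2) - μ[fun ω' => Y t ω' ^ 2 | F t] := rfl
    rw [this, h2]
    simp [h3]

lemma integral_sq_sum_le_of_integral_pow_four_le {F : Filtration ℕ mΩ} {Y : ℕ → Ω → ℝ} {C : ℝ}
    {n : ℕ} (hYm : ∀ t < n, Measurable (Y t))
    (hYF : ∀ t < n, StronglyMeasurable[F (t + 1)] (Y t))
    (hY4 : ∀ t < n, Integrable (fun ω => Y t ω ^ 4) μ)
    (hYC : ∀ t < n, ∫ ω, Y t ω ^ 4 ∂μ ≤ C)
    (hY0 : ∀ t < n, μ[Y t | F t] =ᵐ[μ] 0) :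
    MemLp (fun ω => ∑ t ∈ Finset.range n, Y t ω) 2 μ ∧
    ∫ ω, (∑ t ∈ Finset.range n, Y t ω) ^ 2 ∂μ ≤ n * (1 + C) := by
  have hY2 : ∀ t < n, MemLp (Y t) 2 μ := fun t ht =>
    (memLp_four_of_integrable_pow_four (hYm t ht) (hY4 t ht)).mono_exponent (by norm_num)
  refine ⟨memLp_finsetSum _ fun t ht => hY2 t (Finset.mem_range.1 ht), ?_⟩
  rw [integral_sq_sum_eq_of_condExp_eq_zero n hYF hY2 hY0]
  calc _ ≤ ∑ t ∈ Finset.range n, (1 + C) := by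
        refine Finset.sum_le_sum fun t ht => ?_
        have ht := Finset.mem_range.1 ht
        calc ∫ ω, Y t ω ^ 2 ∂μ ≤ ∫ ω, (1 + Y t ω ^ 4) ∂μ :=
              integral_mono (hY2 t ht).integrable_sq ((integrable_const 1).add (hY4 t ht))
                fun ω => by nlinarith [sq_nonneg (Y t ω ^ 2 - 1), sq_nonneg (Y t ω)]
          _ = 1 + ∫ ω, Y t ω ^ 4 ∂μ := by
              rw [integral_add (integrable_const 1) (hY4 t ht)]; simp
          _ ≤ 1 + C := by gcongr; exact hYC t ht
    _ = n * (1 + C) := by rw [Finset.sum_const, Finset.card_range, nsmul_eq_mul]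

/-- The sample variance of a martingale difference array with bounded fourth moments is consistent
for the limit of its normalized conditional variance. -/
theorem tendsto_measure_sampleVariance_deviation {F : ℕ → Filtration ℕ mΩ}
    {Y : ℕ → ℕ → Ω → ℝ} {V C : ℝ} (hYm : ∀ n, ∀ t < n, Measurable (Y n t))
    (hYF : ∀ n, ∀ t < n, StronglyMeasurable[F n (t + 1)] (Y n t))
    (hY4 : ∀ n, ∀ t < n, Integrable (fun ω => Y n t ω ^ 4) μ)
    (hYC : ∀ n, ∀ t < n, ∫ ω, Y n t ω ^ 4 ∂μ ≤ C)
    (hY0 : ∀ n, ∀ t < n, μ[Y n t | F n t] =ᵐ[μ] 0) (hV : 0 ≤ V)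
    (hstab : ∀ η > (0 : ℝ), Tendsto (fun n : ℕ => μ.real {ω | η <
      |(∑ t ∈ Finset.range n, (μ[fun ω' => Y n t ω' ^ 2 | F n t]) ω) / n - V|}) atTop (𝓝 0))
    {η : ℝ} (hη : 0 < η) :
    Tendsto (fun n : ℕ => μ.real {ω | η < |((n : ℝ) - 1)⁻¹ *
      (∑ t ∈ Finset.range n, Y n t ω ^ 2 - (∑ t ∈ Finset.range n, Y n t ω) ^ 2 / n) - V|})
      atTop (𝓝 0) := by
  have hinv : Tendsto (fun n : ℕ => ((n : ℝ))⁻¹) atTop (𝓝 0) := tendsto_inv_atTop_nhds_zero_nat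
  have hbound : Tendsto (fun n : ℕ => C / (η / 8) ^ 2 * (n : ℝ)⁻¹
      + (1 + C) / (η / 8) * (n : ℝ)⁻¹ + μ.real {ω | η / 8 <
      |(∑ t ∈ Finset.range n, (μ[fun ω' => Y n t ω' ^ 2 | F n t]) ω) / n - V|}) atTop (𝓝 0) := by
    simpa using ((hinv.const_mul (C / (η / 8) ^ 2)).add
      (hinv.const_mul ((1 + C) / (η / 8)))).add (hstab (η / 8) (by positivity))
  have hVn : ∀ᶠ n : ℕ in atTop, V / ((n : ℝ) - 1) ≤ η / 4 := by
    have : Tendsto (fun n : ℕ => V / ((n : ℝ) - 1)) atTop (𝓝 0) :=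
      (tendsto_atTop_add_const_right _ (-1) tendsto_natCast_atTop_atTop).const_div_atTop V
    exact this.eventually_le_const (by positivity)
  refine squeeze_zero' (Eventually.of_forall fun n => measureReal_nonneg) ?_ hbound
  filter_upwards [hVn, eventually_ge_atTop 2] with n hVn hn
  have hn2 : (2 : ℝ) ≤ n := by exact_mod_cast hn
  have hn0 : (0 : ℝ) < n := by linarith
  obtain ⟨hA, hA'⟩ := integral_sq_sum_sq_sub_condExp_le (hYm n) (hYF n) (hY4 n) (hYC n)
  obtain ⟨hB, hB'⟩ := integral_sq_sum_le_of_integral_pow_four_le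
    (hYm n) (hYF n) (hY4 n) (hYC n) (hY0 n)
  have hA'' := measureReal_le_div_of_integral_sq_le hA
    (show 0 < (η / 8 * n) ^ 2 by positivity) hA'
  have hB'' := measureReal_le_div_of_integral_sq_le hB (show 0 < η / 8 * (n : ℝ) ^ 2 by positivity)
    hB'
  have eA : n * C / (η / 8 * n) ^ 2 = C / (η / 8) ^ 2 * (n : ℝ)⁻¹ := by field_simp
  have eB : n * (1 + C) / (η / 8 * (n : ℝ) ^ 2) = (1 + C) / (η / 8) * (n : ℝ)⁻¹ := by field_simp
  rw [← eA, ← eB]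
  refine le_trans (measureReal_mono (fun ω hω => ?_)) ((measureReal_union_le _ _).trans
    (add_le_add ((measureReal_union_le _ _).trans (add_le_add hA'' hB'')) le_rfl))
  rcases deviation_cases_of_lt_abs_sampleVariance_sub
    (Q := ∑ t ∈ Finset.range n, (μ[fun ω' => Y n t ω' ^ 2 | F n t]) ω) hn2 hV hVn hω
    with h | h | h
  · rw [← Finset.sum_sub_distrib] at h
    exact Or.inl (Or.inl h)
  · exact Or.inl (Or.inr h)
  · exact Or.inr h

end

/-- Corollary: non-studentized CLT under variance stabilization.
For each `n ≥ 2` let `(ξ_{n,t})_{1 ≤ t ≤ n}` be a martingale difference array with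
`sup_{n,t} E[ξ_{n,t}⁴] ≤ C`, `S_n := Σ ξ_{n,t}`, `V_n² := Σ E[ξ_{n,t}² | F_{n,t−1}]`, and
suppose `P(V_n² ≥ v·n) → 1` for some `v > 0` and `V_n²/n → V` in probability for some
`V ∈ (0,∞)`. Fix `θ0`, set `φ_{n,t} := ξ_{n,t} + θ0`, `θ̂_n := (1/n) Σ φ_{n,t}`,
`V̂_n := (1/(n−1)) Σ (φ_{n,t} − θ̂_n)²`. Then `√n·(θ̂_n − θ0)` converges in distribution to
`N(0, V)` (expressed via integrals of bounded continuous functions), and `V̂_n → V` in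
probability. -/
theorem nonstudentized_clt_under_stabilization
    {Ω : Type*} {mΩ : MeasurableSpace Ω} {μ : Measure Ω} [IsProbabilityMeasure μ]
    (F : ℕ → Filtration ℕ mΩ)
    (ξ : ℕ → ℕ → Ω → ℝ)
    (hmeas : ∀ n, ∀ t ∈ Finset.Icc 1 n, StronglyMeasurable[F n t] (ξ n t))
    (hmeas' : ∀ n t, Measurable (ξ n t))
    (hint : ∀ n, ∀ t ∈ Finset.Icc 1 n, Integrable (ξ n t) μ)
    (hmds : ∀ n, ∀ t ∈ Finset.Icc 1 n, μ[ξ n t | F n (t - 1)] =ᵐ[μ] 0)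
    (C : ℝ)
    (hmom4 : ∀ n, ∀ t ∈ Finset.Icc 1 n, Integrable (fun ω => (ξ n t ω) ^ 4) μ)
    (hmom4bd : ∀ n, ∀ t ∈ Finset.Icc 1 n, ∫ ω, (ξ n t ω) ^ 4 ∂μ ≤ C)
    (S Vsq : ℕ → Ω → ℝ)
    (hS : S = fun (n : ℕ) (ω : Ω) => ∑ t ∈ Finset.Icc 1 n, ξ n t ω)
    (hVsq : Vsq = fun (n : ℕ) (ω : Ω) =>
      ∑ t ∈ Finset.Icc 1 n, (μ[fun ω' => (ξ n t ω') ^ 2 | F n (t - 1)]) ω)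
    (v : ℝ) (hv : 0 < v)
    (hVgrowth : Tendsto (fun (n : ℕ) => (μ {ω | v * n ≤ Vsq n ω}).toReal) atTop (𝓝 1))
    (V : ℝ) (hV : 0 < V)
    (hstab : ∀ η > (0 : ℝ),
      Tendsto (fun (n : ℕ) => (μ {ω | η < |Vsq n ω / n - V|}).toReal) atTop (𝓝 0))
    (θ0 : ℝ) (φ : ℕ → ℕ → Ω → ℝ) (hφ : φ = fun n t ω => ξ n t ω + θ0)
    (θhat Vhat : ℕ → Ω → ℝ)
    (hθhat : θhat = fun (n : ℕ) (ω : Ω) => (n : ℝ)⁻¹ * ∑ t ∈ Finset.Icc 1 n, φ n t ω)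
    (hVhat : Vhat = fun (n : ℕ) (ω : Ω) =>
      ((n : ℝ) - 1)⁻¹ * ∑ t ∈ Finset.Icc 1 n, (φ n t ω - θhat n ω) ^ 2) :
    (∀ f : BoundedContinuousFunction ℝ ℝ,
      Tendsto (fun (n : ℕ) => ∫ ω, f (Real.sqrt n * (θhat n ω - θ0)) ∂μ)
        atTop (𝓝 (∫ x, f x ∂(gaussianReal 0 V.toNNReal)))) ∧
    (∀ η > (0 : ℝ),
      Tendsto (fun (n : ℕ) => (μ {ω | η < |Vhat n ω - V|}).toReal) atTop (𝓝 0)) := by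
  have hmem : ∀ {n t : ℕ}, t < n → t + 1 ∈ Finset.Icc 1 n := fun h =>
    Finset.mem_Icc.2 ⟨by omega, h⟩
  have hYm : ∀ n, ∀ t < n, Measurable (ξ n (t + 1)) := fun n t _ => hmeas' n (t + 1)
  have hYF : ∀ n, ∀ t < n, StronglyMeasurable[F n (t + 1)] (ξ n (t + 1)) := fun n t ht =>
    hmeas n _ (hmem ht)
  have hY4 : ∀ n, ∀ t < n, Integrable (fun ω => ξ n (t + 1) ω ^ 4) μ := fun n t ht =>
    hmom4 n _ (hmem ht)
  have hYC : ∀ n, ∀ t < n, ∫ ω, ξ n (t + 1) ω ^ 4 ∂μ ≤ C := fun n t ht => hmom4bd n _ (hmem ht)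
  have hY0 : ∀ n, ∀ t < n, μ[ξ n (t + 1) | F n t] =ᵐ[μ] 0 := fun n t ht => hmds n _ (hmem ht)
  have hstab' : ∀ η > (0 : ℝ), Tendsto (fun n : ℕ => μ.real {ω | η <
      |(∑ t ∈ Finset.range n, (μ[fun ω' => ξ n (t + 1) ω' ^ 2 | F n t]) ω) / n - V|})
      atTop (𝓝 0) := by
    simpa only [hVsq, sum_Icc_one_eq_sum_range, Nat.add_sub_cancel] using! hstab
  subst hφ
  refine ⟨fun f => ?_, fun η hη => ?_⟩
  · refine (tendsto_integral_of_tendsto_charFun hV.le (fun n => ?_)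
      (tendsto_charFun_normalized_martingale_sum hYm hYF hY4 hYC hY0 hV.le hstab') f).congr' ?_
    · exact (Finset.measurable_fun_sum _ fun t _ => hmeas' n (t + 1)).const_mul _
    · filter_upwards [eventually_gt_atTop 0] with n hn
      have hn' : (0 : ℝ) < n := by exact_mod_cast hn
      have hs : (0 : ℝ) < √n := Real.sqrt_pos.2 hn'
      refine integral_congr_ae (ae_of_all _ fun ω => congrArg f ?_)
      have hs2 : (n : ℝ)⁻¹ = (√n)⁻¹ * (√n)⁻¹ := by
        rw [← mul_inv, Real.mul_self_sqrt hn'.le]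
      simp only [hθhat, sum_Icc_one_eq_sum_range]
      rw [inv_mul_sum_range_add_const (fun t => ξ n (t + 1) ω) θ0 hn, add_sub_cancel_right, hs2]
      field_simp
  · refine (tendsto_measure_sampleVariance_deviation hYm hYF hY4 hYC hY0 hV.le hstab'
      hη).congr' ?_
    filter_upwards [eventually_gt_atTop 0] with n hn
    have hsum : ∀ ω, ∑ t ∈ Finset.Icc 1 n, (ξ n t ω + θ0 - θhat n ω) ^ 2
        = ∑ t ∈ Finset.range n, ξ n (t + 1) ω ^ 2
          - (∑ t ∈ Finset.range n, ξ n (t + 1) ω) ^ 2 / n := fun ω => by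
      simp only [hθhat, sum_Icc_one_eq_sum_range]
      exact sum_range_sq_deviation_add_const (fun t => ξ n (t + 1) ω) θ0 hn
    simp only [hVhat, hsum]
    rfl
end
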